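/- Let (Λ,F) be an ℝ-building, let α be a point of Λ, and let F_∞ be the direction of some sector-face of Λ. Then there exists a unique sector-face of Λ based at α with direction F_∞. -/

import Mathlib

open Set

noncomputable section

/-- The model space `𝔸`: Euclidean `n`-space. -/
abbrev ModelSpace (n : ℕ) : Type := EuclideanSpace ℝ (Fin n)

/-- A linear reflection of the model space: an involutive isometry, different from the
identity, whose fixed-point set is a linear hyperplane (the kernel of a nonzero linear
functional). -/
def IsLinearReflection {n : ℕ} (s : ModelSpace n ≃ᵢ ModelSpace n) : Prop :=
  s * s = 1 ∧ s ≠ 1 ∧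
    ∃ p : ModelSpace n →ₗ[ℝ] ℝ, p ≠ 0 ∧ {x | s x = x} = {x | p x = 0}

/-- A spherical Coxeter system of rank `n`, realized as a finite reflection group acting
on the model space `ℝⁿ`: a finite set `S` of linear reflections generating a finite
group `W̄`. -/
structure SphericalCoxeterSystem (n : ℕ) where
  S : Set (ModelSpace n ≃ᵢ ModelSpace n)
  finiteS : S.Finite
  refl : ∀ s ∈ S, IsLinearReflection s
  finiteW : Finite ↥(Subgroup.closure S)

namespace SphericalCoxeterSystem

variable {n : ℕ}

/-- The finite reflection group `W̄` generated by `S`. -/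
def Wbar (cs : SphericalCoxeterSystem n) : Subgroup (ModelSpace n ≃ᵢ ModelSpace n) :=
  Subgroup.closure cs.S

/-- A translation of the model space. -/
def IsTranslation (t : ModelSpace n ≃ᵢ ModelSpace n) : Prop :=
  ∃ v : ModelSpace n, ∀ x, t x = x + v

/-- The group `W` of affine transformations generated by `W̄` and all translations. -/
def W (cs : SphericalCoxeterSystem n) : Subgroup (ModelSpace n ≃ᵢ ModelSpace n) :=
  Subgroup.closure (cs.S ∪ {t | IsTranslation t})

/-- An affine reflection: a `W`-conjugate of a generator in `S`. -/
def IsAffineReflection (cs : SphericalCoxeterSystem n)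
    (r : ModelSpace n ≃ᵢ ModelSpace n) : Prop :=
  ∃ s ∈ cs.S, ∃ w ∈ cs.W, r = w * s * w⁻¹

/-- A wall of the model space: the fixed-point set of an affine reflection. -/
def IsModelWall (cs : SphericalCoxeterSystem n) (M : Set (ModelSpace n)) : Prop :=
  ∃ r, cs.IsAffineReflection r ∧ M = {x | r x = x}

/-- A half-apartment of the model space: a closed half-space `H` bounded by the
wall `M` (fixed-point set of the affine reflection `r`). -/
def IsModelHalf (cs : SphericalCoxeterSystem n) (M H : Set (ModelSpace n)) : Prop :=
  ∃ r, cs.IsAffineReflection r ∧ M = {x | r x = x} ∧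
    IsClosed H ∧ Convex ℝ H ∧ H ∪ (⇑r '' H) = univ ∧ H ∩ (⇑r '' H) = M

/-- A sector-face of the model space based at `x`: a closed cell of the arrangement of
all walls through `x` (for each wall through `x` one chooses either the wall itself or
one of its two half-apartments, and takes the intersection of the choices). -/
def IsModelSectorFace (cs : SphericalCoxeterSystem n) (x : ModelSpace n)
    (F : Set (ModelSpace n)) : Prop :=
  F.Nonempty ∧ ∃ σ : Set (ModelSpace n) → Set (ModelSpace n),
    (∀ M, cs.IsModelWall M → x ∈ M → (σ M = M ∨ cs.IsModelHalf M (σ M))) ∧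
    F = ⋂ M ∈ {M | cs.IsModelWall M ∧ x ∈ M}, σ M

/-- A sector of the model space based at `x`: a maximal sector-face based at `x`. -/
def IsModelSector (cs : SphericalCoxeterSystem n) (x : ModelSpace n)
    (F : Set (ModelSpace n)) : Prop :=
  cs.IsModelSectorFace x F ∧ ∀ F', cs.IsModelSectorFace x F' → F ⊆ F' → F' = F

/-- A sector-panel of the model space based at `x`: a sector-face of codimension one. -/
def IsModelSectorPanel (cs : SphericalCoxeterSystem n) (x : ModelSpace n)
    (F : Set (ModelSpace n)) : Prop :=
  cs.IsModelSectorFace x F ∧ Module.finrank ℝ (affineSpan ℝ F).direction = n - 1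

/-- The word length on `W̄` with respect to the generating set `S`. -/
def wordLength (cs : SphericalCoxeterSystem n) (w : ModelSpace n ≃ᵢ ModelSpace n) : ℕ :=
  sInf {k | ∃ l : List (ModelSpace n ≃ᵢ ModelSpace n),
    l.length = k ∧ (∀ s ∈ l, s ∈ cs.S) ∧ l.prod = w}

/-- The longest element of `W̄`. -/
def IsLongest (cs : SphericalCoxeterSystem n) (w : ModelSpace n ≃ᵢ ModelSpace n) : Prop :=
  w ∈ cs.Wbar ∧ ∀ v ∈ cs.Wbar, cs.wordLength v ≤ cs.wordLength w

end SphericalCoxeterSystem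

section Building

variable {n : ℕ} {X : Type*} [MetricSpace X]

/-- Two subsets of a metric space are parallel if their Hausdorff distance is finite. -/
def Par (S T : Set X) : Prop := EMetric.hausdorffEdist S T ≠ ⊤

/-- Two sets locally coincide at `α` (have the same germ at `α`) if their intersection
is a neighbourhood of `α` in both of them. -/
def LocCoin (α : X) (F F' : Set X) : Prop :=
  F ∩ F' ∈ nhdsWithin α F ∧ F ∩ F' ∈ nhdsWithin α F'

variable (cs : SphericalCoxeterSystem n)

/-- An apartment: the image of a chart. -/
def IsApartment (Fc : Set (ModelSpace n → X)) (A : Set X) : Prop :=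
  ∃ f ∈ Fc, A = range f

/-- A sector-face based at `α` : the image under a chart of a sector-face of the model
space, with base point mapped to `α`. -/
def IsSectorFaceAt (Fc : Set (ModelSpace n → X)) (α : X) (F : Set X) : Prop :=
  ∃ f ∈ Fc, ∃ x s, cs.IsModelSectorFace x s ∧ f x = α ∧ F = f '' s

/-- A sector based at `α`. -/
def IsSectorAt (Fc : Set (ModelSpace n → X)) (α : X) (F : Set X) : Prop :=
  ∃ f ∈ Fc, ∃ x s, cs.IsModelSector x s ∧ f x = α ∧ F = f '' s

/-- A sector-panel based at `α`. -/
def IsSectorPanelAt (Fc : Set (ModelSpace n → X)) (α : X) (F : Set X) : Prop :=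
  ∃ f ∈ Fc, ∃ x s, cs.IsModelSectorPanel x s ∧ f x = α ∧ F = f '' s

/-- A sector-face. -/
def IsSectorFace (Fc : Set (ModelSpace n → X)) (F : Set X) : Prop :=
  ∃ α, IsSectorFaceAt cs Fc α F

/-- A sector. -/
def IsSector (Fc : Set (ModelSpace n → X)) (F : Set X) : Prop :=
  ∃ α, IsSectorAt cs Fc α F

/-- A sector-panel. -/
def IsSectorPanel (Fc : Set (ModelSpace n → X)) (F : Set X) : Prop :=
  ∃ α, IsSectorPanelAt cs Fc α F

/-- A wall: the image of a wall of the model space under a chart. -/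
def IsWall (Fc : Set (ModelSpace n → X)) (M : Set X) : Prop :=
  ∃ f ∈ Fc, ∃ m, cs.IsModelWall m ∧ M = f '' m

/-- A half-apartment: the image of a half-apartment of the model space under a chart. -/
def IsHalfApartment (Fc : Set (ModelSpace n → X)) (H : Set X) : Prop :=
  ∃ f ∈ Fc, ∃ m h, cs.IsModelHalf m h ∧ H = f '' h

/-- An ℝ-building of type `(W̄,S)` with set of points `Λ` inside the ambient metric
space `X` (taking `Λ` a subset of an ambient metric space makes it possible to speak of
one ℝ-building being contained in another): a set of isometric charts from the model
space satisfying the axioms (A1)–(A5). -/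
structure RBuilding (cs : SphericalCoxeterSystem n) (X : Type*) [MetricSpace X]
    (Λ : Set X) : Type _ where
  charts : Set (ModelSpace n → X)
  isom : ∀ f ∈ charts, Isometry f
  into : ∀ f ∈ charts, range f ⊆ Λ
  A1 : ∀ f ∈ charts, ∀ w ∈ cs.W, (f ∘ ⇑w) ∈ charts
  A2 : ∀ f ∈ charts, ∀ g ∈ charts,
        IsClosed {x | f x ∈ range g} ∧ Convex ℝ {x | f x ∈ range g} ∧
        ∃ w ∈ cs.W, ∀ x, f x ∈ range g → f x = g (w x)
  A3 : ∀ p ∈ Λ, ∀ q ∈ Λ, ∃ f ∈ charts, p ∈ range f ∧ q ∈ range f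
  A4 : ∀ S₁ S₂, IsSector cs charts S₁ → IsSector cs charts S₂ →
        ∃ T₁ T₂ f, f ∈ charts ∧ IsSector cs charts T₁ ∧ IsSector cs charts T₂ ∧
          T₁ ⊆ S₁ ∧ T₂ ⊆ S₂ ∧ T₁ ⊆ range f ∧ T₂ ⊆ range f
  A5 : ∀ f₁ ∈ charts, ∀ f₂ ∈ charts, ∀ f₃ ∈ charts,
        IsHalfApartment cs charts (range f₁ ∩ range f₂) →
        IsHalfApartment cs charts (range f₂ ∩ range f₃) →
        IsHalfApartment cs charts (range f₁ ∩ range f₃) →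
        (range f₁ ∩ range f₂ ∩ range f₃).Nonempty

/-- The Weyl distance, inside the apartment given by the chart `f`, from the sector `S`
to the sector `S'` (both contained in that apartment): the element `w ∈ W̄` mapping the
sector of the model space based at the origin parallel to `f⁻¹(S)` to the one parallel
to `f⁻¹(S')`. -/
def WeylDistIn (f : ModelSpace n → X) (S S' : Set X)
    (w : ModelSpace n ≃ᵢ ModelSpace n) : Prop :=
  w ∈ cs.Wbar ∧ ∃ s s', cs.IsModelSector 0 s ∧ cs.IsModelSector 0 s' ∧
    Par (f '' s) S ∧ Par (f '' s') S' ∧ ⇑w '' s = s'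

/-- `w` is the Weyl distance from the germ at `α` of the sector `S` to the germ at `α`
of the sector `S'` (both based at `α`): computed via sectors based at `α` with the same
germs lying in a common apartment. -/
def GermWeylDist (Fc : Set (ModelSpace n → X)) (α : X) (S S' : Set X)
    (w : ModelSpace n ≃ᵢ ModelSpace n) : Prop :=
  ∃ f ∈ Fc, ∃ T T', IsSectorAt cs Fc α T ∧ IsSectorAt cs Fc α T' ∧
    T ⊆ range f ∧ T' ⊆ range f ∧ LocCoin α S T ∧ LocCoin α S' T' ∧
    WeylDistIn cs f T T' w

/-- `w` is the Weyl distance between the chambers at infinity represented by the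
sectors `S` and `S'`: computed via parallel sectors lying in a common apartment. -/
def ChamberWeylDist (Fc : Set (ModelSpace n → X)) (S S' : Set X)
    (w : ModelSpace n ≃ᵢ ModelSpace n) : Prop :=
  ∃ f ∈ Fc, ∃ T T', IsSector cs Fc T ∧ IsSector cs Fc T' ∧
    T ⊆ range f ∧ T' ⊆ range f ∧ Par T S ∧ Par T' S' ∧ WeylDistIn cs f T T' w

/-- The germs at `α` of two sectors based at `α` are opposite if their Weyl distance is
the longest element of `W̄`. -/
def OppositeGerms (Fc : Set (ModelSpace n → X)) (α : X) (S S' : Set X) : Prop :=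
  ∃ w, GermWeylDist cs Fc α S S' w ∧ cs.IsLongest w

/-- Two chambers at infinity (represented by the sectors `C`, `D`) are adjacent if they
are distinct and their Weyl distance lies in `S`. -/
def AdjacentChambers (Fc : Set (ModelSpace n → X)) (C D : Set X) : Prop :=
  ¬ Par C D ∧ ∃ s ∈ cs.S, ChamberWeylDist cs Fc C D s

/-- Two sector-panels are asymptotic if they contain a common subset which is itself a
sector-panel. -/
def Asymptotic (Fc : Set (ModelSpace n → X)) (P P' : Set X) : Prop :=
  ∃ Q, IsSectorPanel cs Fc Q ∧ Q ⊆ P ∧ Q ⊆ P'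

/-- An automorphism of an ℝ-building: an isometry `g` of `Λ` with `g ∘ f` a chart for
every chart `f`. -/
def RBuilding.IsAuto {Λ : Set X} (B : RBuilding cs X Λ) (g : ↥Λ ≃ᵢ ↥Λ) : Prop :=
  ∀ f (hf : f ∈ B.charts),
    (fun a : ModelSpace n =>
      ((g ⟨f a, B.into f hf (mem_range_self a)⟩ : ↥Λ) : X)) ∈ B.charts

end Building

section CAT0

/-- `G` is a geodesic segment from `x` to `y`: an isometric image of a closed real
interval with endpoints `x` and `y`. -/
def IsGeodesicSegment {Y : Type*} [MetricSpace Y] (x y : Y) (G : Set Y) : Prop :=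
  ∃ (a b : ℝ) (γ : ℝ → Y), a ≤ b ∧ γ a = x ∧ γ b = y ∧
    (∀ s ∈ Set.Icc a b, ∀ t ∈ Set.Icc a b, dist (γ s) (γ t) = |s - t|) ∧
    G = γ '' Set.Icc a b

/-- A CAT(0) space: a geodesic metric space in which every geodesic triangle satisfies
the CAT(0) comparison inequality with respect to comparison triangles in the Euclidean
plane. -/
def IsCAT0Space (Y : Type*) [MetricSpace Y] : Prop :=
  (∀ x y : Y, ∃ G, IsGeodesicSegment x y G) ∧
  ∀ (x y z : Y) (G : Set Y), IsGeodesicSegment x y G → ∀ a ∈ G,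
    ∀ x' y' z' : EuclideanSpace ℝ (Fin 2),
      dist x' y' = dist x y → dist y' z' = dist y z → dist x' z' = dist x z →
      ∀ a' ∈ segment ℝ x' y', dist x' a' = dist x a → dist z a ≤ dist z' a'

end CAT0

namespace SphericalCoxeterSystem

variable {n : ℕ}

/-- The linear part of an isometry of the model space. -/
def lin (w : ModelSpace n ≃ᵢ ModelSpace n) : ModelSpace n ≃ₗᵢ[ℝ] ModelSpace n :=
  w.toRealAffineIsometryEquiv.linearIsometryEquiv

theorem apply_add (w : ModelSpace n ≃ᵢ ModelSpace n) (x c : ModelSpace n) :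
    w (x + c) = w x + lin w c := by
  have h := w.toRealAffineIsometryEquiv.map_vadd x c
  simp only [vadd_eq_add, IsometryEquiv.coeFn_toRealAffineIsometryEquiv] at h
  rw [add_comm x c, h, add_comm]
  rfl

theorem lin_eq_of_forall {w : ModelSpace n ≃ᵢ ModelSpace n} {g : ModelSpace n → ModelSpace n}
    (h : ∀ x c, w (x + c) = w x + g c) (c : ModelSpace n) : lin w c = g c := by
  have h1 := h 0 c
  rw [apply_add] at h1
  exact add_left_cancel h1

theorem lin_mul (w w' : ModelSpace n ≃ᵢ ModelSpace n) (c : ModelSpace n) :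
    lin (w * w') c = lin w (lin w' c) := by
  refine lin_eq_of_forall (g := fun c => lin w (lin w' c)) (fun x c => ?_) c
  simp only [IsometryEquiv.mul_apply, apply_add]

theorem lin_one (c : ModelSpace n) : lin (1 : ModelSpace n ≃ᵢ ModelSpace n) c = c :=
  lin_eq_of_forall (g := fun c => c) (fun _ _ => rfl) c

theorem lin_lin_inv (w : ModelSpace n ≃ᵢ ModelSpace n) (c : ModelSpace n) :
    lin w (lin w⁻¹ c) = c := by
  rw [← lin_mul, mul_inv_cancel, lin_one]

theorem lin_inv_lin (w : ModelSpace n ≃ᵢ ModelSpace n) (c : ModelSpace n) :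
    lin w⁻¹ (lin w c) = c := by
  rw [← lin_mul, inv_mul_cancel, lin_one]

theorem apply_inv_apply (w : ModelSpace n ≃ᵢ ModelSpace n) (x : ModelSpace n) :
    w (w⁻¹ x) = x := by
  rw [← IsometryEquiv.mul_apply, mul_inv_cancel, IsometryEquiv.coe_one, id]

theorem inv_apply_apply (w : ModelSpace n ≃ᵢ ModelSpace n) (x : ModelSpace n) :
    w⁻¹ (w x) = x := by
  rw [← IsometryEquiv.mul_apply, inv_mul_cancel, IsometryEquiv.coe_one, id]

/-- Translation by a vector. -/
def trans (v : ModelSpace n) : ModelSpace n ≃ᵢ ModelSpace n := IsometryEquiv.addRight v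

theorem trans_apply (v x : ModelSpace n) : trans v x = x + v := rfl

theorem lin_trans (v c : ModelSpace n) : lin (trans v) c = c :=
  lin_eq_of_forall (g := fun c => c) (fun x c => by simp only [trans_apply]; abel) c

variable (cs : SphericalCoxeterSystem n)

theorem trans_mem (v : ModelSpace n) : trans v ∈ cs.W :=
  Subgroup.subset_closure (Or.inr ⟨v, fun _ => rfl⟩)

theorem exists_mem_Wbar_lin {w : ModelSpace n ≃ᵢ ModelSpace n} (hw : w ∈ cs.W) :
    ∃ g ∈ cs.Wbar, ∀ c, lin w c = g c := by
  induction hw using Subgroup.closure_induction with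
  | mem x hx =>
    rcases hx with hx | ⟨v, hv⟩
    · refine ⟨x, Subgroup.subset_closure hx, fun c => ?_⟩
      obtain ⟨-, -, p, -, hp⟩ := cs.refl x hx
      have h0 : x 0 = 0 := by
        have : (0 : ModelSpace n) ∈ {y | p y = 0} := map_zero p
        rw [← hp] at this
        exact this
      have := apply_add x 0 c
      rw [zero_add, h0, zero_add] at this
      exact this.symm
    · refine ⟨1, one_mem _, fun c => ?_⟩
      refine lin_eq_of_forall (g := fun c => c) (fun y c => ?_) c
      rw [hv, hv]; abel
  | one => exact ⟨1, one_mem _, lin_one⟩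
  | mul x y _ _ hx hy =>
    obtain ⟨g, hg, h⟩ := hx
    obtain ⟨g', hg', h'⟩ := hy
    exact ⟨g * g', mul_mem hg hg', fun c => by rw [lin_mul, h', h, IsometryEquiv.mul_apply]⟩
  | inv x _ hx =>
    obtain ⟨g, hg, h⟩ := hx
    refine ⟨g⁻¹, inv_mem hg, fun c => ?_⟩
    apply g.injective
    rw [apply_inv_apply, ← h, lin_lin_inv]

/-- The isometry `r` is the orthogonal reflection in the hyperplane `⟪a, x⟫ = c`. -/
def IsReflectionIn (r : ModelSpace n ≃ᵢ ModelSpace n) (a : ModelSpace n) (c : ℝ) : Prop :=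
  ∀ x, r x = x - (2 * (inner ℝ a x - c)) • a

/-- The unit normals of the walls. -/
def roots : Set (ModelSpace n) :=
  {a | ‖a‖ = 1 ∧ ∃ c r, cs.IsAffineReflection r ∧ IsReflectionIn r a c}

variable {cs}

theorem norm_root {a : ModelSpace n} (ha : a ∈ cs.roots) : ‖a‖ = 1 := ha.1

theorem inner_root_self {a : ModelSpace n} (ha : a ∈ cs.roots) : inner ℝ a a = (1 : ℝ) := by
  rw [real_inner_self_eq_norm_sq, norm_root ha, one_pow]

theorem neg_root {a : ModelSpace n} (ha : a ∈ cs.roots) : -a ∈ cs.roots := by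
  obtain ⟨h, c, r, hr, h'⟩ := ha
  refine ⟨by rwa [norm_neg], -c, r, hr, fun x => ?_⟩
  rw [h' x, inner_neg_left]
  module

theorem IsReflectionIn.conj {r : ModelSpace n ≃ᵢ ModelSpace n} {a : ModelSpace n} {c : ℝ}
    (h : IsReflectionIn r a c) (w : ModelSpace n ≃ᵢ ModelSpace n) :
    IsReflectionIn (w * r * w⁻¹) (lin w a) (c + inner ℝ (lin w a) (w 0)) := by
  intro x
  have h1 : w (w⁻¹ x) = w 0 + lin w (w⁻¹ x) := by rw [← apply_add, zero_add]
  rw [apply_inv_apply] at h1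
  have h2 : (inner ℝ a (w⁻¹ x) : ℝ) = inner ℝ (lin w a) x - inner ℝ (lin w a) (w 0) := by
    rw [← LinearIsometryEquiv.inner_map_map (lin w) a, ← inner_sub_right]
    congr 1
    nth_rw 2 [h1]
    abel
  rw [IsometryEquiv.mul_apply, IsometryEquiv.mul_apply, h, sub_eq_add_neg, apply_add,
    apply_inv_apply, map_neg, map_smul, h2]
  module

theorem IsAffineReflection.conj {r w : ModelSpace n ≃ᵢ ModelSpace n}
    (h : cs.IsAffineReflection r) (hw : w ∈ cs.W) : cs.IsAffineReflection (w * r * w⁻¹) := by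
  obtain ⟨s, hs, v, hv, rfl⟩ := h
  exact ⟨s, hs, w * v, mul_mem hw hv, by group⟩

theorem lin_root {a : ModelSpace n} {w : ModelSpace n ≃ᵢ ModelSpace n} (hw : w ∈ cs.W)
    (ha : a ∈ cs.roots) : lin w a ∈ cs.roots := by
  obtain ⟨h, c, r, hr, h'⟩ := ha
  exact ⟨by rwa [LinearIsometryEquiv.norm_map], _, _, hr.conj hw, h'.conj w⟩

theorem exists_reflection {a : ModelSpace n} (ha : a ∈ cs.roots) (c : ℝ) :
    ∃ r, cs.IsAffineReflection r ∧ IsReflectionIn r a c := by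
  obtain ⟨h, c', r, hr, h'⟩ := ha
  refine ⟨_, hr.conj (cs.trans_mem ((c - c') • a)), ?_⟩
  have := h'.conj (trans ((c - c') • a))
  rw [lin_trans, trans_apply, zero_add, inner_smul_right, real_inner_self_eq_norm_sq, h] at this
  convert this using 1
  ring

theorem exists_isReflectionIn_of_isLinearReflection {s : ModelSpace n ≃ᵢ ModelSpace n}
    (hs : IsLinearReflection s) : ∃ a : ModelSpace n, ‖a‖ = 1 ∧ IsReflectionIn s a 0 := by
  obtain ⟨hss, hs1, p, hp, hfix⟩ := hs
  have hfix' : ∀ x, s x = x ↔ p x = 0 := fun x => by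
    have := Set.ext_iff.1 hfix x
    exact this
  set b := (InnerProductSpace.toDual ℝ (ModelSpace n)).symm (LinearMap.toContinuousLinearMap p)
    with hb
  have hbp : ∀ x, p x = inner ℝ b x := fun x => by
    rw [hb, InnerProductSpace.toDual_symm_apply]; rfl
  have hb0 : b ≠ 0 := by
    intro h
    apply hp
    ext x
    rw [hbp, h, inner_zero_left]; rfl
  have hbn : ‖b‖ ≠ 0 := norm_ne_zero_iff.2 hb0
  set a := ‖b‖⁻¹ • b with ha
  have han : ‖a‖ = 1 := by
    rw [ha, norm_smul, norm_inv, norm_norm, inv_mul_cancel₀ hbn]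
  have haa : inner ℝ a a = (1 : ℝ) := by rw [real_inner_self_eq_norm_sq, han, one_pow]
  have hfa : ∀ x, s x = x ↔ inner ℝ a x = (0 : ℝ) := fun x => by
    rw [hfix', hbp, ha, real_inner_smul_left]
    simp [hbn]
  have h0 : s 0 = 0 := (hfa 0).2 (inner_zero_right _)
  have hlin : ∀ x, s x = lin s x := fun x => by
    have := apply_add s 0 x
    rwa [zero_add, h0, zero_add] at this
  have hort : ∀ y, inner ℝ a y = (0 : ℝ) → inner ℝ (s a) y = (0 : ℝ) := fun y hy => by
    have h1 : s y = y := (hfa y).2 hy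
    rw [← h1, hlin, hlin, LinearIsometryEquiv.inner_map_map, hy]
  set l : ℝ := inner ℝ (s a) a with hl
  have hdec : ∀ x : ModelSpace n, inner ℝ a (x - (inner ℝ a x : ℝ) • a) = (0 : ℝ) := fun x => by
    rw [inner_sub_right, real_inner_smul_right, haa]; ring
  have hsa : s a = l • a := by
    refine ext_inner_right ℝ fun x => ?_
    have hx : x = (inner ℝ a x : ℝ) • a + (x - (inner ℝ a x : ℝ) • a) := by abel
    rw [real_inner_smul_left]
    conv_lhs => rw [hx]
    rw [inner_add_right, hort _ (hdec x), real_inner_smul_right, ← hl]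
    ring
  have hsx : ∀ x, s x = x + ((l - 1) * inner ℝ a x) • a := fun x => by
    have hx : x = (inner ℝ a x : ℝ) • a + (x - (inner ℝ a x : ℝ) • a) := by abel
    have h1 : s (x - (inner ℝ a x : ℝ) • a) = x - (inner ℝ a x : ℝ) • a := (hfa _).2 (hdec x)
    conv_lhs => rw [hx]
    rw [hlin, map_add, map_smul, ← hlin, ← hlin, h1, hsa]
    module
  have hll : l * l = 1 := by
    have h1 : s (s a) = a := by rw [← IsometryEquiv.mul_apply, hss]; rfl
    rw [hsa, hlin, map_smul, ← hlin, hsa] at h1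
    have := congrArg (fun y => (inner ℝ a y : ℝ)) h1
    simpa [real_inner_smul_right, haa, han] using this
  have hl1 : l ≠ 1 := by
    intro h
    apply hs1
    ext1 x
    rw [hsx, h]; simp
  have hl2 : l = -1 := by
    rcases mul_self_eq_one_iff.1 hll with h | h
    · exact absurd h hl1
    · exact h
  refine ⟨a, han, fun x => ?_⟩
  rw [hsx, hl2]
  module

theorem IsAffineReflection.exists_root {r : ModelSpace n ≃ᵢ ModelSpace n}
    (h : cs.IsAffineReflection r) : ∃ a ∈ cs.roots, ∃ c, IsReflectionIn r a c := by
  have h' := h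
  obtain ⟨s, hs, w, hw, rfl⟩ := h
  obtain ⟨a, ha, hsa⟩ := exists_isReflectionIn_of_isLinearReflection (cs.refl s hs)
  exact ⟨lin w a, ⟨by rwa [LinearIsometryEquiv.norm_map], _, _, h', hsa.conj w⟩, _, hsa.conj w⟩

theorem IsAffineReflection.mem_W {r : ModelSpace n ≃ᵢ ModelSpace n}
    (h : cs.IsAffineReflection r) : r ∈ cs.W := by
  obtain ⟨s, hs, w, hw, rfl⟩ := h
  exact mul_mem (mul_mem hw (Subgroup.subset_closure (Or.inl hs))) (inv_mem hw)

theorem eq_or_eq_neg_of_reflection {a b : ModelSpace n} (ha : ‖a‖ = 1) (hb : ‖b‖ = 1)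
    (h : ∀ x : ModelSpace n, (inner ℝ a x : ℝ) • a = (inner ℝ b x : ℝ) • b) : a = b ∨ a = -b := by
  have h1 := h a
  rw [real_inner_self_eq_norm_sq, ha, one_pow, one_smul] at h1
  have h2 : |(inner ℝ b a : ℝ)| = 1 := by
    have := congrArg norm h1
    rwa [norm_smul, ha, hb, mul_one, Real.norm_eq_abs, eq_comm] at this
  rcases eq_or_eq_neg_of_abs_eq h2 with h3 | h3 <;> rw [h3] at h1
  · left; rw [h1, one_smul]
  · right; rw [h1, neg_one_smul]

theorem finite_roots : cs.roots.Finite := by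
  have hfin : Finite ↥cs.Wbar := cs.finiteW
  have hsub : cs.roots ⊆ ⋃ g : ↥cs.Wbar,
      {a | ‖a‖ = 1 ∧ ∀ c, g.1 c = c - (2 * inner ℝ a c) • a} := by
    rintro a ⟨ha, c, r, hr, h⟩
    obtain ⟨g, hg, hgl⟩ := cs.exists_mem_Wbar_lin hr.mem_W
    refine mem_iUnion.2 ⟨⟨g, hg⟩, ha, fun y => ?_⟩
    rw [← hgl]
    refine lin_eq_of_forall (g := fun y => y - (2 * inner ℝ a y : ℝ) • a) (fun x y => ?_) y
    rw [h, h, inner_add_right]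
    module
  refine (Set.finite_iUnion fun g => ?_).subset hsub
  rcases Set.eq_empty_or_nonempty {a : ModelSpace n | ‖a‖ = 1 ∧
    ∀ c, g.1 c = c - (2 * inner ℝ a c) • a} with h | ⟨b, hb, hgb⟩
  · rw [h]; exact Set.finite_empty
  · refine (Set.toFinite {b, -b}).subset ?_
    rintro a ⟨ha, hga⟩
    refine eq_or_eq_neg_of_reflection ha hb fun x => ?_
    have h1 := (hga x).symm.trans (hgb x)
    have h2 : (2 : ℝ) • ((inner ℝ a x : ℝ) • a) = (2 : ℝ) • ((inner ℝ b x : ℝ) • b) := by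
      rw [smul_smul, smul_smul]
      exact sub_right_injective h1
    exact smul_right_injective _ two_ne_zero h2

end SphericalCoxeterSystem

namespace SphericalCoxeterSystem

variable {n : ℕ} (cs : SphericalCoxeterSystem n)

/-- The closed cell (with apex `0`) of the linear wall arrangement whose relative interior
contains `v`. -/
def cone (v : ModelSpace n) : Set (ModelSpace n) :=
  {y | ∀ a ∈ cs.roots, (0 : ℝ) ≤ inner ℝ a v → (0 : ℝ) ≤ inner ℝ a y}

/-- A vector lying on no linear wall. -/
def Regular (v : ModelSpace n) : Prop := ∀ a ∈ cs.roots, (inner ℝ a v : ℝ) ≠ 0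

variable {cs} {u v y z : ModelSpace n} {w : ModelSpace n ≃ᵢ ModelSpace n}

theorem self_mem_cone : v ∈ cs.cone v := fun _ _ h => h

theorem zero_mem_cone : (0 : ModelSpace n) ∈ cs.cone v := fun _ _ _ => by
  rw [inner_zero_right]

theorem add_mem_cone (hy : y ∈ cs.cone v) (hz : z ∈ cs.cone v) : y + z ∈ cs.cone v :=
  fun a ha h => by rw [inner_add_right]; exact add_nonneg (hy a ha h) (hz a ha h)

theorem smul_mem_cone {t : ℝ} (ht : 0 ≤ t) (hy : y ∈ cs.cone v) : t • y ∈ cs.cone v :=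
  fun a ha h => by rw [real_inner_smul_right]; exact mul_nonneg ht (hy a ha h)

theorem cone_subset (h : z ∈ cs.cone v) : cs.cone z ⊆ cs.cone v :=
  fun _ hy a ha hv => hy a ha (h a ha hv)

theorem cone_eq_of_mem_of_regular (hv : cs.Regular v) (h : v ∈ cs.cone z) :
    cs.cone z = cs.cone v := by
  refine Set.Subset.antisymm (fun y hy a ha hav => hy a ha ?_) (cone_subset h)
  by_contra! hz
  have := h (-a) (neg_root ha) (by rw [inner_neg_left]; linarith)
  rw [inner_neg_left] at this
  exact hv a ha (by linarith)

theorem smul_cone {t : ℝ} (ht : 0 < t) : cs.cone (t • v) = cs.cone v := by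
  ext y
  refine forall₂_congr fun a _ => ?_
  rw [real_inner_smul_right, mul_nonneg_iff_of_pos_left ht]

theorem Regular.smul {t : ℝ} (hv : cs.Regular v) (ht : t ≠ 0) : cs.Regular (t • v) :=
  fun a ha => by rw [real_inner_smul_right]; exact mul_ne_zero ht (hv a ha)

theorem inner_lin_eq (w : ModelSpace n ≃ᵢ ModelSpace n) (a y : ModelSpace n) :
    (inner ℝ a (lin w y) : ℝ) = inner ℝ (lin w⁻¹ a) y := by
  rw [← LinearIsometryEquiv.inner_map_map (lin w) (lin w⁻¹ a) y, lin_lin_inv]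

theorem lin_mem_cone (hw : w ∈ cs.W) (hy : y ∈ cs.cone v) : lin w y ∈ cs.cone (lin w v) := by
  intro a ha h
  rw [inner_lin_eq] at h ⊢
  exact hy _ (lin_root (inv_mem hw) ha) h

theorem Regular.lin (hv : cs.Regular v) (hw : w ∈ cs.W) :
    cs.Regular (SphericalCoxeterSystem.lin w v) := by
  intro a ha
  rw [inner_lin_eq]
  exact hv _ (lin_root (inv_mem hw) ha)

theorem isClosed_cone : IsClosed (cs.cone v) := by
  have : cs.cone v = ⋂ a ∈ cs.roots, {y | (0 : ℝ) ≤ inner ℝ a v → (0 : ℝ) ≤ inner ℝ a y} := by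
    ext y; simp [cone]
  rw [this]
  refine isClosed_biInter fun a _ => ?_
  by_cases h : (0 : ℝ) ≤ inner ℝ a v
  · simp only [h, true_imp_iff]
    exact isClosed_le continuous_const (continuous_const.inner continuous_id)
  · simp [h]

/-- Adding a large multiple of `v` to `m` makes all signs of `v` prevail. -/
theorem exists_forall_smul_add_pos (cs : SphericalCoxeterSystem n) (v m : ModelSpace n) :
    ∃ t : ℝ, 0 < t ∧ ∀ a ∈ cs.roots, (0 : ℝ) < inner ℝ a v →
      (0 : ℝ) < inner ℝ a (t • v + m) := by
  have h : ∀ᶠ t : ℝ in Filter.atTop, ∀ a ∈ cs.roots, (0 : ℝ) < inner ℝ a v →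
      (0 : ℝ) < inner ℝ a (t • v + m) := by
    rw [Filter.eventually_all_finite finite_roots]
    intro a ha
    by_cases h : (0 : ℝ) < inner ℝ a v
    · filter_upwards [Filter.eventually_gt_atTop (-(inner ℝ a m : ℝ) / inner ℝ a v)] with t ht _
      rw [inner_add_right, real_inner_smul_right]
      rw [div_lt_iff₀ h] at ht
      linarith
    · exact Filter.Eventually.of_forall fun t h' => absurd h' h
  obtain ⟨t, h1, h2⟩ := ((Filter.eventually_gt_atTop (0 : ℝ)).and h).exists
  exact ⟨t, h1, h2⟩

theorem exists_smul_add_mem_cone {m : ModelSpace n}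
    (h : ∀ a ∈ cs.roots, (inner ℝ a v : ℝ) = 0 → (0 : ℝ) ≤ inner ℝ a m) :
    ∃ t : ℝ, 0 < t ∧ t • v + m ∈ cs.cone v := by
  obtain ⟨t, ht, h1⟩ := cs.exists_forall_smul_add_pos v m
  refine ⟨t, ht, fun a ha hav => ?_⟩
  rcases hav.eq_or_lt with h2 | h2
  · rw [inner_add_right, real_inner_smul_right, ← h2, mul_zero, zero_add]
    exact h a ha h2.symm
  · exact (h1 a ha h2).le

theorem Regular.exists_smul_add_mem_cone (hv : cs.Regular v) (m : ModelSpace n) :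
    ∃ t : ℝ, 0 < t ∧ t • v + m ∈ cs.cone v :=
  SphericalCoxeterSystem.exists_smul_add_mem_cone fun a ha h => absurd h (hv a ha)

/-- Finitely many nonzero linear functionals can be made nonzero simultaneously. -/
theorem exists_forall_inner_ne_zero {T : Set (ModelSpace n)} (hT : T.Finite)
    (h0 : ∀ a ∈ T, a ≠ 0) : ∃ m : ModelSpace n, ∀ a ∈ T, (inner ℝ a m : ℝ) ≠ 0 := by
  classical
  set s : Finset (Subspace ℝ (ModelSpace n)) := hT.toFinset.image fun a => (ℝ ∙ a)ᗮ with hs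
  have hne : (⋃ p ∈ s, (p : Set (ModelSpace n))) ≠ Set.univ := by
    refine Subspace.biUnion_ne_univ_of_top_notMem ?_
    rw [hs, Finset.mem_image]
    rintro ⟨a, ha, h⟩
    refine h0 a (hT.mem_toFinset.1 ha) ?_
    have : a ∈ (ℝ ∙ a)ᗮ := by rw [h]; trivial
    rw [Submodule.mem_orthogonal_singleton_iff_inner_right] at this
    exact inner_self_eq_zero.1 this
  obtain ⟨m, hm⟩ := (Set.ne_univ_iff_exists_notMem _).1 hne
  refine ⟨m, fun a ha h => hm ?_⟩
  refine Set.mem_iUnion₂.2 ⟨(ℝ ∙ a)ᗮ, ?_, ?_⟩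
  · exact Finset.mem_image.2 ⟨a, hT.mem_toFinset.2 ha, rfl⟩
  · exact Submodule.mem_orthogonal_singleton_iff_inner_right.2 h

/-- Near `v` there is a vector on which finitely many prescribed nonzero functionals do not
vanish; after rescaling it lies in the open star of `v`. -/
theorem exists_generic (cs : SphericalCoxeterSystem n) (v : ModelSpace n)
    {T : Set (ModelSpace n)} (hT : T.Finite) (h0 : ∀ a ∈ T, a ≠ 0) :
    ∃ u : ModelSpace n, (∀ a ∈ T, (inner ℝ a u : ℝ) ≠ 0) ∧
      ∀ a ∈ cs.roots, (0 : ℝ) < inner ℝ a v → (0 : ℝ) < inner ℝ a u := by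
  obtain ⟨m, hm⟩ := exists_forall_inner_ne_zero hT h0
  have h : ∀ᶠ t : ℝ in Filter.atTop, ∀ a ∈ cs.roots, (0 : ℝ) < inner ℝ a v →
      (0 : ℝ) < inner ℝ a (t • v + m) := by
    rw [Filter.eventually_all_finite finite_roots]
    intro a ha
    by_cases h : (0 : ℝ) < inner ℝ a v
    · filter_upwards [Filter.eventually_gt_atTop (-(inner ℝ a m : ℝ) / inner ℝ a v)] with t ht _
      rw [inner_add_right, real_inner_smul_right]
      rw [div_lt_iff₀ h] at ht
      linarith
    · exact Filter.Eventually.of_forall fun t h' => absurd h' h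
  have h' : ∀ᶠ t : ℝ in Filter.atTop, ∀ a ∈ T, (inner ℝ a (t • v + m) : ℝ) ≠ 0 := by
    rw [Filter.eventually_all_finite hT]
    intro a ha
    by_cases h : (inner ℝ a v : ℝ) = 0
    · refine Filter.Eventually.of_forall fun t => ?_
      rw [inner_add_right, real_inner_smul_right, h, mul_zero, zero_add]
      exact hm a ha
    · filter_upwards [Filter.eventually_gt_atTop (-(inner ℝ a m : ℝ) / inner ℝ a v)] with t ht
      rw [inner_add_right, real_inner_smul_right]
      intro h1
      refine ht.ne ?_
      rw [div_eq_iff h]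
      linarith
  obtain ⟨t, h1, h2⟩ := (h.and h').exists
  exact ⟨_, h2, h1⟩

theorem root_ne_zero {a : ModelSpace n} (ha : a ∈ cs.roots) : a ≠ 0 := by
  rintro rfl
  simpa using norm_root ha

theorem exists_regular_mem_cone (cs : SphericalCoxeterSystem n) (z : ModelSpace n) :
    ∃ u, cs.Regular u ∧ z ∈ cs.cone u := by
  obtain ⟨u, h1, h2⟩ := cs.exists_generic z finite_roots fun a ha => root_ne_zero ha
  refine ⟨u, h1, fun a ha hu => ?_⟩
  by_contra! hz
  have := h2 (-a) (neg_root ha) (by rw [inner_neg_left]; linarith)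
  rw [inner_neg_left] at this
  linarith

/-! ### Walls, half-apartments and sector-faces of the model space -/

theorem IsReflectionIn.apply_eq_iff {r : ModelSpace n ≃ᵢ ModelSpace n} {a x : ModelSpace n} {c : ℝ}
    (h : IsReflectionIn r a c) (ha : ‖a‖ = 1) : r x = x ↔ (inner ℝ a x : ℝ) = c := by
  rw [h x, sub_eq_self, smul_eq_zero]
  have ha0 : a ≠ 0 := by rintro rfl; simp at ha
  simp only [ha0, or_false, mul_eq_zero, OfNat.ofNat_ne_zero, false_or, sub_eq_zero]

theorem isModelWall_iff {M : Set (ModelSpace n)} :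
    cs.IsModelWall M ↔ ∃ a ∈ cs.roots, ∃ c : ℝ, M = {x | inner ℝ a x = c} := by
  constructor
  · rintro ⟨r, hr, rfl⟩
    obtain ⟨a, ha, c, h⟩ := hr.exists_root
    exact ⟨a, ha, c, Set.ext fun x => h.apply_eq_iff (norm_root ha)⟩
  · rintro ⟨a, ha, c, rfl⟩
    obtain ⟨r, hr, h⟩ := exists_reflection ha c
    exact ⟨r, hr, Set.ext fun x => (h.apply_eq_iff (norm_root ha)).symm⟩

theorem IsReflectionIn.inner_apply {r : ModelSpace n ≃ᵢ ModelSpace n} {a : ModelSpace n} {c : ℝ}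
    (h : IsReflectionIn r a c) (ha : ‖a‖ = 1) (x : ModelSpace n) :
    (inner ℝ a (r x) : ℝ) = 2 * c - inner ℝ a x := by
  rw [h x, inner_sub_right, real_inner_smul_right, real_inner_self_eq_norm_sq, ha]
  ring

theorem IsReflectionIn.apply_apply {r : ModelSpace n ≃ᵢ ModelSpace n} {a : ModelSpace n} {c : ℝ}
    (h : IsReflectionIn r a c) (ha : ‖a‖ = 1) (x : ModelSpace n) : r (r x) = x := by
  rw [h (r x), h.inner_apply ha, h x]
  module

theorem isModelHalf_halfSpace {a : ModelSpace n} (ha : a ∈ cs.roots) (c : ℝ) :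
    cs.IsModelHalf {x | inner ℝ a x = c} {x | c ≤ inner ℝ a x} := by
  obtain ⟨r, hr, h⟩ := exists_reflection ha c
  have hna := norm_root ha
  have himg : ∀ x, x ∈ r '' {x | c ≤ inner ℝ a x} ↔ inner ℝ a x ≤ c := by
    intro x
    constructor
    · rintro ⟨y, hy, rfl⟩
      have hy : c ≤ inner ℝ a y := hy
      rw [h.inner_apply hna]; linarith
    · intro hx
      refine ⟨r x, ?_, h.apply_apply hna x⟩
      show c ≤ inner ℝ a (r x)
      rw [h.inner_apply hna]; linarith
  refine ⟨r, hr, Set.ext fun x => (h.apply_eq_iff hna).symm, ?_, ?_, ?_, ?_⟩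
  · exact isClosed_le continuous_const (continuous_const.inner continuous_id)
  · exact convex_halfSpace_ge (f := fun x => (inner ℝ a x : ℝ))
      ⟨fun x y => inner_add_right _ _ _, fun t x => real_inner_smul_right _ _ _⟩ c
  · ext x
    rw [Set.mem_union, himg]
    simpa using le_total c (inner ℝ a x)
  · ext x
    rw [Set.mem_inter_iff, himg]
    exact ⟨fun h => le_antisymm h.2 h.1, fun h => ⟨h.ge, h.le⟩⟩

theorem IsModelHalf.exists_eq_halfSpace {M H : Set (ModelSpace n)} (h : cs.IsModelHalf M H) :
    ∃ a ∈ cs.roots, ∃ c : ℝ, M = {x | inner ℝ a x = c} ∧ H = {x | c ≤ inner ℝ a x} := by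
  obtain ⟨r, hr, hM, hcl, -, hun, hinter⟩ := h
  obtain ⟨a₀, ha₀, c₀, hra₀⟩ := hr.exists_root
  have hM₀ : M = {x | inner ℝ a₀ x = c₀} := by
    rw [hM]; exact Set.ext fun x => hra₀.apply_eq_iff (norm_root ha₀)
  have hMH : M ⊆ H := hinter ▸ Set.inter_subset_left
  have hne : ∃ p ∈ H, p ∉ M := by
    by_contra! hcon
    have h1 : H = M := Set.Subset.antisymm hcon hMH
    have h2 : r '' M ⊆ M := by
      rintro _ ⟨y, hy, rfl⟩
      have hy' := hy
      rw [hM] at hy'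
      have : r y = y := hy'
      rwa [this]
    have h3 : (c₀ + 1) • a₀ ∈ H ∪ r '' H := by rw [hun]; trivial
    rw [h1, Set.union_eq_left.2 h2, hM₀] at h3
    have h4 : (inner ℝ a₀ ((c₀ + 1) • a₀) : ℝ) = c₀ := h3
    rw [real_inner_smul_right, inner_root_self ha₀] at h4
    linarith
  obtain ⟨p, hpH, hpM⟩ := hne
  have key : ∀ a ∈ cs.roots, ∀ c, M = {x | inner ℝ a x = c} → IsReflectionIn r a c →
      c < inner ℝ a p → H = {x | c ≤ inner ℝ a x} := by
    intro a ha c hMa hra hp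
    have hna := norm_root ha
    have hrr := hra.apply_apply hna
    have hclr : IsClosed (r '' H) := r.toHomeomorph.isClosedMap _ hcl
    have hconv : Convex ℝ {x : ModelSpace n | c < inner ℝ a x} :=
      convex_halfSpace_gt (f := fun x => (inner ℝ a x : ℝ))
        ⟨fun x y => inner_add_right _ _ _, fun t x => real_inner_smul_right _ _ _⟩ c
    have hpos : ∀ x : ModelSpace n, c < inner ℝ a x → x ∈ H ∧ x ∉ r '' H := by
      have hnot : ∀ x : ModelSpace n, c < inner ℝ a x → x ∈ H → x ∉ r '' H := by
        intro x hx h1 h2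
        have : x ∈ M := hinter ▸ ⟨h1, h2⟩
        rw [hMa] at this
        exact hx.ne' this
      have hall : ∀ x : ModelSpace n, c < inner ℝ a x → x ∉ r '' H := by
        intro x hx hx'
        obtain ⟨y, hy1, hy2⟩ := isPreconnected_closed_iff.1 hconv.isPreconnected H (r '' H) hcl hclr
          (by rw [hun]; exact Set.subset_univ _) ⟨p, hp, hpH⟩ ⟨x, hx, hx'⟩
        exact hnot y hy1 hy2.1 hy2.2
      intro x hx
      have : x ∈ H ∪ r '' H := by rw [hun]; trivial
      exact ⟨this.resolve_right (hall x hx), hall x hx⟩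
    ext x
    rcases lt_trichotomy c (inner ℝ a x) with hx | hx | hx
    · exact ⟨fun _ => hx.le, fun _ => (hpos x hx).1⟩
    · exact ⟨fun _ => hx.le, fun _ => hMH (by rw [hMa]; exact hx.symm)⟩
    · refine ⟨fun hxH => ?_, fun hx' => absurd hx (not_lt.2 hx')⟩
      exfalso
      refine (hpos (r x) ?_).2 ⟨x, hxH, rfl⟩
      rw [hra.inner_apply hna]; linarith
  have hp0 : (inner ℝ a₀ p : ℝ) ≠ c₀ := by
    rw [hM₀] at hpM; exact hpM
  rcases hp0.lt_or_gt with hlt | hlt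
  · have hM₁ : M = {x | inner ℝ (-a₀) x = -c₀} := by
      rw [hM₀]; ext x; simp [inner_neg_left]
    refine ⟨-a₀, neg_root ha₀, -c₀, hM₁, key _ (neg_root ha₀) _ hM₁ ?_ ?_⟩
    · intro x; rw [hra₀ x, inner_neg_left]; module
    · rw [inner_neg_left]; linarith
  · exact ⟨a₀, ha₀, c₀, hM₀, key a₀ ha₀ c₀ hM₀ hra₀ hlt⟩

/-- A wall determines its unit normal up to sign. -/
theorem eq_or_eq_neg_of_wall_eq {a b x : ModelSpace n} (ha : ‖a‖ = 1) (hb : ‖b‖ = 1)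
    (h : ∀ y : ModelSpace n, (inner ℝ a y : ℝ) = inner ℝ a x → (inner ℝ b y : ℝ) = inner ℝ b x) :
    a = b ∨ a = -b := by
  have haa : (inner ℝ a a : ℝ) = 1 := by rw [real_inner_self_eq_norm_sq, ha, one_pow]
  have h1 : b = (inner ℝ b a : ℝ) • a := by
    refine ext_inner_right ℝ fun y => ?_
    have := h (x + (y - (inner ℝ a y : ℝ) • a)) (by
      rw [inner_add_right, inner_sub_right, real_inner_smul_right, haa]; ring)
    rw [inner_add_right, inner_sub_right, real_inner_smul_right] at this
    rw [real_inner_smul_left]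
    linarith
  have h2 : |(inner ℝ b a : ℝ)| = 1 := by
    have := congrArg norm h1
    rwa [norm_smul, ha, hb, mul_one, Real.norm_eq_abs, eq_comm] at this
  rcases eq_or_eq_neg_of_abs_eq h2 with h3 | h3 <;> rw [h3] at h1
  · left; rw [h1, one_smul]
  · right; rw [h1, neg_one_smul, neg_neg]

theorem IsModelSectorFace.exists_cone {x : ModelSpace n} {F : Set (ModelSpace n)}
    (h : cs.IsModelSectorFace x F) : ∃ z, F = {y | y - x ∈ cs.cone z} := by
  classical
  obtain ⟨-, σ, hσ, rfl⟩ := h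
  set F := ⋂ M ∈ {M | cs.IsModelWall M ∧ x ∈ M}, σ M with hF
  -- the sign conditions cutting out `F`
  have hcond : ∀ b ∈ cs.roots, (∀ y ∈ F, (0 : ℝ) ≤ inner ℝ b (y - x)) ∨
      (∀ y ∈ F, (inner ℝ b (y - x) : ℝ) ≤ 0) := by
    intro b hb
    have hw : cs.IsModelWall {y | inner ℝ b y = (inner ℝ b x : ℝ)} :=
      isModelWall_iff.2 ⟨b, hb, _, rfl⟩
    have hsub : F ⊆ σ {y | inner ℝ b y = (inner ℝ b x : ℝ)} :=
      Set.biInter_subset_of_mem (show _ ∈ {M | cs.IsModelWall M ∧ x ∈ M} from ⟨hw, rfl⟩)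
    rcases hσ _ hw rfl with h | h
    · left; intro y hy
      have := hsub hy
      rw [h] at this
      have : (inner ℝ b y : ℝ) = inner ℝ b x := this
      rw [inner_sub_right]; linarith
    · obtain ⟨a, ha, c, h1, h2⟩ := h.exists_eq_halfSpace
      have hc : (inner ℝ a x : ℝ) = c := by
        have : x ∈ {y | inner ℝ b y = (inner ℝ b x : ℝ)} := rfl
        rw [h1] at this; exact this
      have hab : b = a ∨ b = -a := eq_or_eq_neg_of_wall_eq (x := x) (norm_root hb) (norm_root ha)
        fun y hy => by
          have : y ∈ {y | inner ℝ b y = (inner ℝ b x : ℝ)} := hy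
          rw [h1] at this
          rw [hc]; exact this
      have hy' : ∀ y ∈ F, (0 : ℝ) ≤ inner ℝ a (y - x) := fun y hy => by
        have := hsub hy
        rw [h2] at this
        have : c ≤ inner ℝ a y := this
        rw [inner_sub_right]; linarith
      rcases hab with rfl | rfl
      · exact Or.inl hy'
      · right; intro y hy; rw [inner_neg_left]; linarith [hy' y hy]
  have hex : ∀ b : ModelSpace n, ∃ y ∈ F, ((∃ y' ∈ F, (inner ℝ b (y' - x) : ℝ) ≠ 0) →
      (inner ℝ b (y - x) : ℝ) ≠ 0) := by
    have hx : x ∈ F := by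
      refine Set.mem_iInter₂.2 fun M hM => ?_
      rcases hσ M hM.1 hM.2 with h | h
      · rw [h]; exact hM.2
      · obtain ⟨a, ha, c, h1, h2⟩ := h.exists_eq_halfSpace
        rw [h2]
        have := hM.2
        rw [h1] at this
        exact (show (inner ℝ a x : ℝ) = c from this).ge
    intro b
    by_cases h : ∃ y' ∈ F, (inner ℝ b (y' - x) : ℝ) ≠ 0
    · obtain ⟨y', h1, h2⟩ := h
      exact ⟨y', h1, fun _ => h2⟩
    · exact ⟨x, hx, fun h' => absurd h' h⟩
  choose p hpF hp using hex
  set z := ∑ b ∈ finite_roots.toFinset (s := cs.roots), (p b - x) with hz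
  have hinz : ∀ b : ModelSpace n, (inner ℝ b z : ℝ) =
      ∑ b' ∈ finite_roots.toFinset (s := cs.roots), inner ℝ b (p b' - x) := fun b => by
    rw [hz, inner_sum]
  have hneg : ∀ b ∈ cs.roots, (∃ y ∈ F, (inner ℝ b (y - x) : ℝ) < 0) →
      (inner ℝ b z : ℝ) < 0 := by
    rintro b hb ⟨y, hy, hlt⟩
    have hle : ∀ y ∈ F, (inner ℝ b (y - x) : ℝ) ≤ 0 :=
      (hcond b hb).resolve_left fun h => absurd (h y hy) (not_le.2 hlt)
    rw [hinz]
    refine Finset.sum_neg' (fun b' _ => hle _ (hpF b')) ⟨b, finite_roots.mem_toFinset.2 hb, ?_⟩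
    exact lt_of_le_of_ne (hle _ (hpF b)) (hp b ⟨y, hy, hlt.ne⟩)
  refine ⟨z, Set.Subset.antisymm (fun y hy b hb hbz => ?_) fun y hy => ?_⟩
  · by_contra! hlt
    exact absurd (hneg b hb ⟨y, hy, hlt⟩) (not_lt.2 hbz)
  · have hy : y - x ∈ cs.cone z := hy
    refine Set.mem_iInter₂.2 fun M hM => ?_
    have hFM : F ⊆ σ M := Set.biInter_subset_of_mem hM
    rcases hσ M hM.1 hM.2 with h | h
    · obtain ⟨b, hb, c, h1⟩ := isModelWall_iff.1 hM.1
      have hbx : (inner ℝ b x : ℝ) = c := by have := hM.2; rw [h1] at this; exact this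
      have hbz : (inner ℝ b z : ℝ) = 0 := by
        rw [hinz]
        refine Finset.sum_eq_zero fun b' _ => ?_
        have := hFM (hpF b')
        rw [h, h1] at this
        have : (inner ℝ b (p b') : ℝ) = c := this
        rw [inner_sub_right]; linarith
      have h2 := hy b hb hbz.ge
      have h3 := hy (-b) (neg_root hb) (by rw [inner_neg_left, hbz, neg_zero])
      rw [inner_neg_left] at h3
      rw [inner_sub_right] at h2 h3
      rw [h, h1]
      show (inner ℝ b y : ℝ) = c
      linarith
    · obtain ⟨a, ha, c, h1, h2⟩ := h.exists_eq_halfSpace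
      have hax : (inner ℝ a x : ℝ) = c := by have := hM.2; rw [h1] at this; exact this
      have h3 := hy a ha (by
        rw [hinz]
        refine Finset.sum_nonneg fun b' _ => ?_
        have := hFM (hpF b')
        rw [h2] at this
        have : c ≤ inner ℝ a (p b') := this
        rw [inner_sub_right]; linarith)
      rw [inner_sub_right] at h3
      rw [h2]
      show c ≤ inner ℝ a y
      linarith

theorem isModelSectorFace_cone (cs : SphericalCoxeterSystem n) (x z : ModelSpace n) :
    cs.IsModelSectorFace x {y | y - x ∈ cs.cone z} := by
  refine ⟨⟨x, by rw [Set.mem_ofPred_eq, sub_self]; exact zero_mem_cone⟩, fun M =>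
    {y | ∀ a ∈ cs.roots, M = {y' | inner ℝ a y' = (inner ℝ a x : ℝ)} → (0 : ℝ) ≤ inner ℝ a z →
      (0 : ℝ) ≤ inner ℝ a (y - x)}, fun M hM hxM => ?_, ?_⟩
  · -- normalize the normal of `M` so that it is nonnegative on `z`
    have hM' : ∃ b ∈ cs.roots, M = {y | inner ℝ b y = (inner ℝ b x : ℝ)} ∧
        (0 : ℝ) ≤ inner ℝ b z := by
      obtain ⟨b, hb, c, h1⟩ := isModelWall_iff.1 hM
      have hbx : (inner ℝ b x : ℝ) = c := by rw [h1] at hxM; exact hxM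
      subst hbx
      rcases le_total (0 : ℝ) (inner ℝ b z) with h | h
      · exact ⟨b, hb, h1, h⟩
      · refine ⟨-b, neg_root hb, ?_, by rw [inner_neg_left]; linarith⟩
        rw [h1]; ext y; simp [inner_neg_left]
    obtain ⟨b, hb, hMb, hbz⟩ := hM'
    have hor : ∀ a ∈ cs.roots, M = {y' | inner ℝ a y' = (inner ℝ a x : ℝ)} → a = b ∨ a = -b := by
      intro a ha h
      refine eq_or_eq_neg_of_wall_eq (x := x) (norm_root ha) (norm_root hb) fun y hy => ?_
      have : y ∈ M := by rw [h]; exact hy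
      rw [hMb] at this
      exact this
    have hMnb : M = {y' | inner ℝ (-b) y' = (inner ℝ (-b) x : ℝ)} := by
      rw [hMb]; ext y; simp [inner_neg_left]
    rcases hbz.eq_or_lt with hz | hz
    · left
      ext y
      constructor
      · intro hy
        have h1 := hy b hb hMb hbz
        have h2 := hy (-b) (neg_root hb) hMnb (by rw [inner_neg_left, ← hz, neg_zero])
        rw [inner_neg_left] at h2
        rw [inner_sub_right] at h1 h2
        rw [hMb]
        show (inner ℝ b y : ℝ) = inner ℝ b x
        linarith
      · intro hy a ha hMa _
        rw [hMa] at hy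
        have : (inner ℝ a y : ℝ) = inner ℝ a x := hy
        rw [inner_sub_right]; linarith
    · right
      have h1 := isModelHalf_halfSpace hb (inner ℝ b x)
      rw [← hMb] at h1
      convert h1 using 1
      ext y
      constructor
      · intro hy
        have := hy b hb hMb hbz
        rw [inner_sub_right] at this
        show (inner ℝ b x : ℝ) ≤ inner ℝ b y
        linarith
      · intro hy a ha hMa haz
        have hy : (inner ℝ b x : ℝ) ≤ inner ℝ b y := hy
        rcases hor a ha hMa with rfl | rfl
        · rw [inner_sub_right]; linarith
        · rw [inner_neg_left] at haz; linarith
  · ext y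
    constructor
    · intro hy
      exact Set.mem_iInter₂.2 fun M _ a ha _ haz => hy a ha haz
    · intro hy a ha haz
      exact Set.mem_iInter₂.1 hy {y' | inner ℝ a y' = (inner ℝ a x : ℝ)}
        ⟨isModelWall_iff.2 ⟨a, ha, _, rfl⟩, rfl⟩ a ha rfl haz

theorem IsModelSector.exists_regular {x : ModelSpace n} {F : Set (ModelSpace n)}
    (h : cs.IsModelSector x F) : ∃ v, cs.Regular v ∧ F = {y | y - x ∈ cs.cone v} := by
  obtain ⟨z, rfl⟩ := h.1.exists_cone
  obtain ⟨u, hu, hz⟩ := cs.exists_regular_mem_cone z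
  exact ⟨u, hu, (h.2 _ (cs.isModelSectorFace_cone x u) fun y hy => cone_subset hz hy).symm⟩

theorem isModelSector_cone (x : ModelSpace n) (hv : cs.Regular v) :
    cs.IsModelSector x {y | y - x ∈ cs.cone v} := by
  refine ⟨cs.isModelSectorFace_cone x v, fun F' hF' hsub => ?_⟩
  obtain ⟨z, rfl⟩ := hF'.exists_cone
  have h1 : x + v ∈ {y | y - x ∈ cs.cone v} := by
    rw [Set.mem_ofPred_eq, add_sub_cancel_left]; exact self_mem_cone
  have h2 : v ∈ cs.cone z := by
    have h3 : x + v - x ∈ cs.cone z := hsub h1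
    rwa [add_sub_cancel_left] at h3
  rw [cone_eq_of_mem_of_regular hv h2]

end SphericalCoxeterSystem

namespace SphericalCoxeterSystem

section Agree

variable {n : ℕ} {X : Type*}

/-- The maps `f` and `g` agree on some translate of `C`. -/
def Agree (f g : ModelSpace n → X) (C : Set (ModelSpace n)) : Prop :=
  ∃ x, ∀ c ∈ C, f (x + c) = g (x + c)

variable {f g h : ModelSpace n → X} {x u v : ModelSpace n} {w : ModelSpace n ≃ᵢ ModelSpace n}

theorem Agree.refl (f : ModelSpace n → X) (C : Set (ModelSpace n)) : Agree f f C :=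
  ⟨0, fun _ _ => rfl⟩

theorem Agree.symm {C : Set (ModelSpace n)} (h : Agree f g C) : Agree g f C := by
  obtain ⟨x, hx⟩ := h
  exact ⟨x, fun c hc => (hx c hc).symm⟩

variable {cs : SphericalCoxeterSystem n}

theorem Agree.trans (hv : cs.Regular v) (h₁ : Agree f g (cs.cone v)) (h₂ : Agree g h (cs.cone v)) :
    Agree f h (cs.cone v) := by
  obtain ⟨x, hx⟩ := h₁
  obtain ⟨y, hy⟩ := h₂
  obtain ⟨t, ht, hm⟩ := hv.exists_smul_add_mem_cone (y - x)
  refine ⟨y + t • v, fun c hc => ?_⟩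
  have h1 := hx _ (add_mem_cone hm hc)
  have h2 := hy _ (add_mem_cone (smul_mem_cone ht.le self_mem_cone) hc)
  rw [show x + (t • v + (y - x) + c) = y + t • v + c by abel] at h1
  rw [← add_assoc] at h2
  rw [h1, h2]

theorem Agree.comp (hw : w ∈ cs.W) (h : Agree f g (cs.cone (lin w v))) :
    Agree (f ∘ w) (g ∘ w) (cs.cone v) := by
  obtain ⟨x, hx⟩ := h
  refine ⟨w⁻¹ x, fun c hc => ?_⟩
  simpa only [Function.comp, apply_add, apply_inv_apply] using hx _ (lin_mem_cone hw hc)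

theorem add_mem_setOf_sub_mem {C : Set (ModelSpace n)} {c : ModelSpace n} (hc : c ∈ C) :
    x + c ∈ {y | y - x ∈ C} := by
  show x + c - x ∈ C
  rwa [add_sub_cancel_left]

end Agree

variable {n : ℕ} {cs : SphericalCoxeterSystem n} {X : Type*} [MetricSpace X]

/-- The rays `t ↦ f (t • y)` and `t ↦ g (t • x)` stay at bounded distance. -/
def Asym (f : ModelSpace n → X) (y : ModelSpace n) (g : ModelSpace n → X) (x : ModelSpace n) :
    Prop :=
  ∃ M : ℝ, ∀ t : ℝ, 0 ≤ t → dist (f (t • y)) (g (t • x)) ≤ M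

variable {f g h : ModelSpace n → X} {x y z x' y' u v : ModelSpace n}
  {w : ModelSpace n ≃ᵢ ModelSpace n}

theorem Asym.refl (f : ModelSpace n → X) (y : ModelSpace n) : Asym f y f y :=
  ⟨0, fun _ _ => by rw [dist_self]⟩

theorem Asym.symm (h : Asym f y g x) : Asym g x f y := by
  obtain ⟨M, hM⟩ := h
  exact ⟨M, fun t ht => by rw [dist_comm]; exact hM t ht⟩

theorem Asym.trans (h₁ : Asym f y g x) (h₂ : Asym g x h z) : Asym f y h z := by
  obtain ⟨M, hM⟩ := h₁
  obtain ⟨N, hN⟩ := h₂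
  exact ⟨M + N, fun t ht => (dist_triangle _ _ _).trans (add_le_add (hM t ht) (hN t ht))⟩

theorem Asym.smul (h : Asym f y g x) {s : ℝ} (hs : 0 ≤ s) : Asym f (s • y) g (s • x) := by
  obtain ⟨M, hM⟩ := h
  exact ⟨M, fun t ht => by simpa only [smul_smul] using hM (t * s) (mul_nonneg ht hs)⟩

theorem Asym.norm_sub_le (hf : Isometry f) (hg : Isometry g) (h₁ : Asym f y g y')
    (h₂ : Asym f x g x') : ‖y - x‖ ≤ ‖y' - x'‖ := by
  obtain ⟨M, hM⟩ := h₁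
  obtain ⟨N, hN⟩ := h₂
  by_contra! hlt
  have key : ∀ t : ℝ, 0 ≤ t → t * (‖y - x‖ - ‖y' - x'‖) ≤ M + N := by
    intro t ht
    have e1 : dist (f (t • y)) (f (t • x)) = t * ‖y - x‖ := by
      rw [hf.dist_eq, dist_eq_norm, ← smul_sub, norm_smul, Real.norm_of_nonneg ht]
    have e2 : dist (g (t • y')) (g (t • x')) = t * ‖y' - x'‖ := by
      rw [hg.dist_eq, dist_eq_norm, ← smul_sub, norm_smul, Real.norm_of_nonneg ht]
    have t1 := dist_triangle4 (f (t • y)) (g (t • y')) (g (t • x')) (f (t • x))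
    have t2 := hM t ht
    have t3 := hN t ht
    rw [dist_comm (f (t • x))] at t3
    linarith
  have hpos : 0 < ‖y - x‖ - ‖y' - x'‖ := sub_pos.2 hlt
  have h0 := key 0 le_rfl
  have h1 := key ((M + N + 1) / (‖y - x‖ - ‖y' - x'‖)) (by
    apply div_nonneg _ hpos.le; linarith)
  rw [div_mul_cancel₀ _ hpos.ne'] at h1
  linarith

theorem Asym.norm_sub_eq (hf : Isometry f) (hg : Isometry g) (h₁ : Asym f y g y')
    (h₂ : Asym f x g x') : ‖y - x‖ = ‖y' - x'‖ :=
  le_antisymm (h₁.norm_sub_le hf hg h₂) (h₁.symm.norm_sub_le hg hf h₂.symm)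

theorem Asym.eq (hf : Isometry f) (h : Asym f y f x) : y = x := by
  have := (Asym.refl f y).norm_sub_le hf hf h.symm
  rw [sub_self, norm_zero] at this
  have h2 := h.norm_sub_le hf hf (Asym.refl f x)
  rw [sub_self, norm_zero, norm_le_zero_iff, sub_eq_zero] at h2
  exact h2

theorem asym_comp_lin (hf : Isometry f) (w : ModelSpace n ≃ᵢ ModelSpace n) (y : ModelSpace n) :
    Asym (f ∘ w) y f (lin w y) := by
  refine ⟨‖w 0‖, fun t _ => le_of_eq ?_⟩
  have : w (t • y) = w 0 + t • lin w y := by rw [← map_smul, ← apply_add, zero_add]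
  rw [Function.comp, hf.dist_eq, this, dist_eq_norm, add_sub_cancel_right]

theorem Agree.asym (hf : Isometry f) (hg : Isometry g) (h : Agree f g (cs.cone v))
    (hy : y ∈ cs.cone v) : Asym f y g y := by
  obtain ⟨x, hx⟩ := h
  refine ⟨‖x‖ + ‖x‖, fun t ht => ?_⟩
  refine (dist_triangle _ (f (x + t • y)) _).trans (add_le_add (le_of_eq ?_) (le_of_eq ?_))
  · rw [hf.dist_eq, dist_comm, dist_eq_norm, add_sub_cancel_right]
  · rw [hx _ (smul_mem_cone ht hy), hg.dist_eq, dist_eq_norm, add_sub_cancel_right]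

theorem add_mem_of_ray {E : Set (ModelSpace n)} (hE : IsClosed E) (hc : Convex ℝ E)
    (hray : ∀ t : ℝ, 0 ≤ t → x + t • y ∈ E) (hz : z ∈ E) : z + y ∈ E := by
  have hlim : Filter.Tendsto (fun s : ℝ => (1 - s) • z + s • x + y) (nhdsWithin 0 (Ioi 0))
      (nhds (z + y)) := by
    have : ContinuousAt (fun s : ℝ => (1 - s) • z + s • x + y) 0 := by fun_prop
    have h2 := this.tendsto
    simp only [sub_zero, one_smul, zero_smul, add_zero] at h2
    exact h2.mono_left nhdsWithin_le_nhds
  refine hE.mem_of_tendsto hlim ?_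
  filter_upwards [Ioo_mem_nhdsGT (zero_lt_one (α := ℝ))] with s hs
  have h1 := hc hz (hray s⁻¹ (inv_nonneg.2 hs.1.le)) (sub_nonneg.2 hs.2.le) hs.1.le (by ring)
  rwa [smul_add, smul_smul, mul_inv_cancel₀ hs.1.ne', one_smul, ← add_assoc] at h1

end SphericalCoxeterSystem

namespace RBuilding

open SphericalCoxeterSystem

variable {n : ℕ} {cs : SphericalCoxeterSystem n} {X : Type*} [MetricSpace X] {Λ : Set X}
  (B : RBuilding cs X Λ) {f g h : ModelSpace n → X} {x y z u v : ModelSpace n}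
  {w : ModelSpace n ≃ᵢ ModelSpace n}

theorem eq_of_mem_range (hf : f ∈ B.charts) (hg : g ∈ B.charts) (hv : cs.Regular v)
    (hfg : Agree f g (cs.cone v)) (hx : f x ∈ range g) : f x = g x := by
  obtain ⟨-, -, w, -, hw⟩ := B.A2 f hf g hg
  obtain ⟨x₀, hx₀⟩ := hfg
  have h1 : ∀ c ∈ cs.cone v, w (x₀ + c) = x₀ + c := fun c hc => by
    have e := hx₀ c hc
    have := hw (x₀ + c) (by rw [e]; exact mem_range_self _)
    exact (B.isom g hg).injective (by rw [← this, e])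
  have h0 := h1 0 zero_mem_cone
  rw [add_zero] at h0
  have h2 : ∀ c ∈ cs.cone v, lin w c = c := fun c hc => by
    have := h1 c hc
    rwa [apply_add, h0, add_right_inj] at this
  have h3 : ∀ m, lin w m = m := fun m => by
    obtain ⟨t, ht, hm⟩ := hv.exists_smul_add_mem_cone m
    have := h2 _ hm
    rwa [map_add, h2 _ (smul_mem_cone ht.le self_mem_cone), add_right_inj] at this
  have h4 : w x = x := by
    have := apply_add w x₀ (x - x₀)
    rwa [h3, h0, add_sub_cancel] at this
  rw [hw x hx, h4]

theorem setOf_mem_range_eq (hf : f ∈ B.charts) (hg : g ∈ B.charts) (hv : cs.Regular v)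
    (hfg : Agree f g (cs.cone v)) : {x | f x ∈ range g} = {x | f x = g x} := by
  ext x
  exact ⟨fun hx => B.eq_of_mem_range hf hg hv hfg hx, fun hx => ⟨x, hx.symm⟩⟩

theorem isClosed_setOf_eq (hf : f ∈ B.charts) (hg : g ∈ B.charts) (hv : cs.Regular v)
    (hfg : Agree f g (cs.cone v)) : IsClosed {x | f x = g x} := by
  rw [← B.setOf_mem_range_eq hf hg hv hfg]
  exact (B.A2 f hf g hg).1

theorem convex_setOf_eq (hf : f ∈ B.charts) (hg : g ∈ B.charts) (hv : cs.Regular v)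
    (hfg : Agree f g (cs.cone v)) : Convex ℝ {x | f x = g x} := by
  rw [← B.setOf_mem_range_eq hf hg hv hfg]
  exact (B.A2 f hf g hg).2.1

theorem add_mem_setOf_eq (hf : f ∈ B.charts) (hg : g ∈ B.charts) (hv : cs.Regular v)
    (hfg : Agree f g (cs.cone v)) (hu : Agree f g (cs.cone u)) (hx : f x = g x)
    (hy : y ∈ cs.cone u) : f (x + y) = g (x + y) := by
  obtain ⟨x₀, h₀⟩ := hu
  exact add_mem_of_ray (B.isClosed_setOf_eq hf hg hv hfg) (B.convex_setOf_eq hf hg hv hfg)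
    (fun t ht => h₀ _ (smul_mem_cone ht hy)) hx

theorem exists_agree_comp (hf : f ∈ B.charts) (hh : h ∈ B.charts)
    (hy : ∀ c ∈ cs.cone v, f (y + c) ∈ range h) :
    ∃ w ∈ cs.W, Agree f (h ∘ w) (cs.cone v) := by
  obtain ⟨-, -, w, hwW, hw⟩ := B.A2 f hf h hh
  exact ⟨w, hwW, y, fun c hc => hw _ (hy c hc)⟩

/-- Every subsector of `f '' cone v` contains a translate of `f '' cone v`. -/
theorem exists_translate_subset (hf : f ∈ B.charts) {T : Set X}
    (hT : IsSector cs B.charts T) (hsub : T ⊆ f '' {y | y - 0 ∈ cs.cone v}) :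
    ∃ y, ∀ c ∈ cs.cone v, f (y + c) ∈ T := by
  obtain ⟨α, k, hk, x, s, hs, -, rfl⟩ := hT
  obtain ⟨v₁, hv₁, rfl⟩ := hs.exists_regular
  obtain ⟨-, -, w, hwW, hw⟩ := B.A2 k hk f hf
  have hfi := (B.isom f hf).injective
  have h1 : ∀ c ∈ cs.cone v₁, w x + lin w c ∈ cs.cone v ∧ k (x + c) = f (w x + lin w c) := by
    intro c hc
    obtain ⟨y, hy, e⟩ := hsub ⟨x + c, add_mem_setOf_sub_mem hc, rfl⟩
    have e2 := hw (x + c) ⟨y, e⟩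
    rw [apply_add] at e2
    have e3 := hfi (e.trans e2)
    rw [← e3]
    exact ⟨by simpa using hy, e.symm⟩
  have h2 : lin w v₁ ∈ cs.cone v := by
    intro a ha hav
    by_contra! hneg
    have key : ∀ t : ℝ, 0 ≤ t → 0 ≤ inner ℝ a (w x) + t * inner ℝ a (lin w v₁) := fun t ht => by
      have := (h1 _ (smul_mem_cone ht self_mem_cone)).1 a ha hav
      rwa [inner_add_right, map_smul, real_inner_smul_right] at this
    have k0 := key 0 le_rfl
    have k1 := key ((inner ℝ a (w x) + 1) / (-inner ℝ a (lin w v₁))) (by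
      apply div_nonneg <;> linarith)
    rw [div_mul_eq_mul_div, mul_div_assoc, div_neg, div_self hneg.ne] at k1
    linarith
  have h3 := (cone_eq_of_mem_of_regular (hv₁.lin hwW) h2).symm
  refine ⟨w x, fun c hc => ?_⟩
  rw [← h3] at hc
  have h4 : lin w⁻¹ c ∈ cs.cone v₁ := by
    have := lin_mem_cone (inv_mem hwW) hc
    rwa [lin_inv_lin] at this
  have h5 := (h1 _ h4).2
  rw [lin_lin_inv] at h5
  exact ⟨x + lin w⁻¹ c, add_mem_setOf_sub_mem h4, h5⟩

theorem exists_chart_agree (hf : f ∈ B.charts) (hg : g ∈ B.charts) (hv : cs.Regular v)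
    (hu : cs.Regular u) :
    ∃ h ∈ B.charts, ∃ w ∈ cs.W, Agree f h (cs.cone v) ∧ Agree g (h ∘ w) (cs.cone u) := by
  obtain ⟨T₁, T₂, k, hk, hT₁, hT₂, hs₁, hs₂, hr₁, hr₂⟩ := B.A4 (f '' {y | y - 0 ∈ cs.cone v})
    (g '' {y | y - 0 ∈ cs.cone u}) ⟨_, f, hf, 0, _, isModelSector_cone 0 hv, rfl, rfl⟩
    ⟨_, g, hg, 0, _, isModelSector_cone 0 hu, rfl, rfl⟩
  obtain ⟨y₁, h₁⟩ := B.exists_translate_subset hf hT₁ hs₁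
  obtain ⟨y₂, h₂⟩ := B.exists_translate_subset hg hT₂ hs₂
  obtain ⟨w₁, hw₁, a₁⟩ := B.exists_agree_comp hf hk fun c hc => hr₁ (h₁ c hc)
  obtain ⟨w₂, hw₂, a₂⟩ := B.exists_agree_comp hg hk fun c hc => hr₂ (h₂ c hc)
  refine ⟨k ∘ w₁, B.A1 k hk w₁ hw₁, w₁⁻¹ * w₂, mul_mem (inv_mem hw₁) hw₂, a₁, ?_⟩
  convert a₂ using 1
  ext x
  simp only [Function.comp, IsometryEquiv.mul_apply, apply_inv_apply]

end RBuilding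

theorem dist_le_mul_of_closed_cover {E : Type*} [PseudoMetricSpace E] {φ : ℝ → E} {L b : ℝ}
    (s : Finset (Set ℝ)) : ∀ a ≤ b, (∀ K ∈ s, IsClosed K) →
      (∀ K ∈ s, ∀ x ∈ K, ∀ y ∈ K, dist (φ x) (φ y) ≤ L * |x - y|) →
      Icc a b ⊆ ⋃ K ∈ s, K → dist (φ a) (φ b) ≤ L * (b - a) := by
  classical
  induction s using Finset.strongInduction with
  | H s ih =>
    intro a hab hcl hlip hcov
    obtain ⟨K, hK, haK⟩ := mem_iUnion₂.1 (hcov (left_mem_Icc.2 hab))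
    have hcomp : IsCompact (K ∩ Icc a b) := isCompact_Icc.inter_left (hcl K hK)
    have hc := hcomp.sSup_mem ⟨a, haK, left_mem_Icc.2 hab⟩
    set c := sSup (K ∩ Icc a b) with hcdef
    have h1 : dist (φ a) (φ c) ≤ L * (c - a) := by
      have := hlip K hK a haK c hc.1
      rwa [abs_sub_comm, abs_of_nonneg (sub_nonneg.2 hc.2.1)] at this
    rcases eq_or_lt_of_le hc.2.2 with hcb | hcb
    · rwa [hcb] at h1
    have h2 : dist (φ c) (φ b) ≤ L * (b - c) := by
      refine ih (s.erase K) (Finset.erase_ssubset hK) c hcb.le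
        (fun K' hK' => hcl K' (Finset.mem_of_mem_erase hK'))
        (fun K' hK' => hlip K' (Finset.mem_of_mem_erase hK')) ?_
      rw [← closure_Ioc hcb.ne]
      refine closure_minimal (fun x hx => ?_)
        ((s.erase K).finite_toSet.isClosed_biUnion fun K' hK' =>
          hcl K' (Finset.mem_of_mem_erase hK'))
      obtain ⟨K', hK', hxK'⟩ := mem_iUnion₂.1 (hcov ⟨hc.2.1.trans hx.1.le, hx.2⟩)
      refine mem_iUnion₂.2 ⟨K', Finset.mem_erase.2 ⟨?_, hK'⟩, hxK'⟩
      rintro rfl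
      exact absurd (le_csSup hcomp.bddAbove ⟨hxK', hc.2.1.trans hx.1.le, hx.2⟩) (not_le.2 hx.1)
    have := dist_triangle (φ a) (φ c) (φ b)
    linarith

/-- A map that does not increase distances on each of finitely many closed sets covering a
real normed space does not increase distances. -/
theorem dist_le_of_closed_cover {V E : Type*} [NormedAddCommGroup V] [NormedSpace ℝ V]
    [PseudoMetricSpace E] {ρ : V → E} {S : Set (Set V)} (hS : S.Finite)
    (hcl : ∀ K ∈ S, IsClosed K) (hcov : ∀ x, ∃ K ∈ S, x ∈ K)
    (hlip : ∀ K ∈ S, ∀ x ∈ K, ∀ y ∈ K, dist (ρ x) (ρ y) ≤ dist x y) (v u : V) :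
    dist (ρ v) (ρ u) ≤ dist v u := by
  classical
  have hγ : Continuous fun t : ℝ => v + t • (u - v) := by fun_prop
  have := dist_le_mul_of_closed_cover (φ := fun t : ℝ => ρ (v + t • (u - v))) (L := dist v u)
    (b := 1) (hS.toFinset.image fun K => (fun t : ℝ => v + t • (u - v)) ⁻¹' K) 0 zero_le_one
    ?_ ?_ ?_
  · simpa using this
  · intro K' hK'
    obtain ⟨K, hK, rfl⟩ := Finset.mem_image.1 hK'
    exact (hcl K (hS.mem_toFinset.1 hK)).preimage hγ
  · intro K' hK'
    obtain ⟨K, hK, rfl⟩ := Finset.mem_image.1 hK'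
    intro x hx y hy
    refine (hlip K (hS.mem_toFinset.1 hK) _ hx _ hy).trans (le_of_eq ?_)
    rw [dist_eq_norm, add_sub_add_left_eq_sub, ← sub_smul, norm_smul, Real.norm_eq_abs, mul_comm,
      dist_comm v, dist_eq_norm]
  · intro t _
    obtain ⟨K, hK, ht⟩ := hcov (v + t • (u - v))
    exact mem_iUnion₂.2 ⟨_, Finset.mem_image_of_mem _ (hS.mem_toFinset.2 hK), ht⟩

namespace SphericalCoxeterSystem

variable {n : ℕ} {cs : SphericalCoxeterSystem n} {u v : ModelSpace n}

theorem finite_range_cone : (range cs.cone).Finite := by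
  refine (cs.finite_roots.finite_subsets.image
    fun s => {y : ModelSpace n | ∀ a ∈ s, (0 : ℝ) ≤ inner ℝ a y}).subset ?_
  rintro _ ⟨z, rfl⟩
  refine ⟨{a | a ∈ cs.roots ∧ (0 : ℝ) ≤ inner ℝ a z}, fun a ha => ha.1, ?_⟩
  ext y
  exact ⟨fun h a ha h' => h a ⟨ha, h'⟩, fun h a ha => h a ha.1 ha.2⟩

theorem Regular.of_pos (hu : cs.Regular u)
    (h : ∀ a ∈ cs.roots, (0 : ℝ) < inner ℝ a u → (0 : ℝ) < inner ℝ a v) :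
    cs.Regular v ∧ cs.cone v = cs.cone u := by
  have hv : cs.Regular v := fun a ha => by
    rcases lt_or_gt_of_ne (hu a ha) with h1 | h1
    · have := h (-a) (neg_root ha) (by rw [inner_neg_left]; linarith)
      rw [inner_neg_left] at this
      linarith
    · exact (h a ha h1).ne'
  refine ⟨hv, (cone_eq_of_mem_of_regular hv fun a ha h1 => ?_).symm⟩
  exact (h a ha (lt_of_le_of_ne h1 (hu a ha).symm)).le

theorem eq_of_inner_eq_on_cone {p p' : ModelSpace n} (hu : cs.Regular u)
    (h : ∀ x ∈ cs.cone u, (inner ℝ p x : ℝ) = inner ℝ p' x) : p = p' := by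
  refine ext_inner_right ℝ fun m => ?_
  obtain ⟨t, ht, hm⟩ := hu.exists_smul_add_mem_cone m
  have := h _ hm
  rwa [inner_add_right, inner_add_right, h _ (smul_mem_cone ht.le self_mem_cone),
    add_right_inj] at this

end SphericalCoxeterSystem

namespace RBuilding

open SphericalCoxeterSystem

variable {n : ℕ} {cs : SphericalCoxeterSystem n} {X : Type*} [MetricSpace X] {Λ : Set X}
  (B : RBuilding cs X Λ) {f g h k : ModelSpace n → X} {x y z u v q : ModelSpace n}
  {w : ModelSpace n ≃ᵢ ModelSpace n}

theorem eq_of_asym (hg : g ∈ B.charts) (hh : h ∈ B.charts) (hk : k ∈ B.charts)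
    (hu : cs.Regular u) (hgh : Agree g h (cs.cone u)) (hgk : Agree g k (cs.cone u))
    (h₁ : Asym f y h x) (h₂ : Asym f y k z) : x = z := by
  have hig := B.isom g hg
  have hih := B.isom h hh
  have hik := B.isom k hk
  have key : ∀ c ∈ cs.cone u, ‖x - c‖ = ‖z - c‖ := fun c hc =>
    (h₁.symm.trans h₂).norm_sub_eq hih hik
      (((hgh.asym hig hih hc).symm).trans (hgk.asym hig hik hc))
  refine eq_of_inner_eq_on_cone hu fun c hc => ?_
  have h0 := key 0 zero_mem_cone
  rw [sub_zero, sub_zero] at h0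
  have h1 := congrArg (· ^ 2) (key c hc)
  simp only [norm_sub_sq_real, h0] at h1
  linarith

/-- If `f` and `g` agree on a sector in direction `cone v` and have the same ray in direction `q`,
then they agree on a sector in direction `cone (q + v)`. -/
theorem agree_add (hf : f ∈ B.charts) (hg : g ∈ B.charts) (hv : cs.Regular v)
    (hu : cs.Regular (q + v)) (hfg : Agree f g (cs.cone v)) (hq : Asym f q g q)
    (hqu : q ∈ cs.cone (q + v)) : Agree f g (cs.cone (q + v)) := by
  set u := q + v with hudef
  have hif := B.isom f hf
  have hig := B.isom g hg
  have hex : ∀ z, cs.Regular z → ∃ h ∈ B.charts, ∃ w ∈ cs.W, Agree g h (cs.cone u) ∧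
      Agree f (h ∘ w) (cs.cone z) ∧ ∀ y ∈ cs.cone z, Asym f y h (lin w y) := by
    intro z hz
    obtain ⟨h, hh, w, hw, a₁, a₂⟩ := B.exists_chart_agree hg hf hu hz
    exact ⟨h, hh, w, hw, a₁, a₂, fun y hy =>
      (a₂.asym hif (B.isom _ (B.A1 h hh w hw)) hy).trans (asym_comp_lin (B.isom h hh) w y)⟩
  have hex' : ∀ y, ∃ p, ∃ h ∈ B.charts, Agree g h (cs.cone u) ∧ Asym f y h p := by
    intro y
    obtain ⟨z, hz, hyz⟩ := cs.exists_regular_mem_cone y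
    obtain ⟨h, hh, w, -, a₁, -, a₂⟩ := hex z hz
    exact ⟨_, h, hh, a₁, a₂ y hyz⟩
  choose ρ hρ using hex'
  have huniq : ∀ y p h, h ∈ B.charts → Agree g h (cs.cone u) → Asym f y h p → ρ y = p := by
    intro y p h hh hgh ha
    obtain ⟨k, hk, hgk, hka⟩ := hρ y
    exact B.eq_of_asym hg hk hh hu hgk hgh hka ha
  obtain ⟨h, hh, w, hw, hgh, hfh, hfw⟩ := hex u hu
  have hρv : ρ v = v := huniq v v g hg (Agree.refl _ _) (hfg.asym hif hig self_mem_cone)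
  have hρq : lin w q = q := by
    rw [← huniq q (lin w q) h hh hgh (hfw q hqu)]
    exact huniq q q g hg (Agree.refl _ _) hq
  have hρu : ρ u = lin w u := huniq u _ h hh hgh (hfw u self_mem_cone)
  have hdist : dist (ρ v) (ρ u) ≤ dist v u := by
    refine dist_le_of_closed_cover (finite_range_cone (cs := cs).subset
      (image_subset_range cs.cone {z | cs.Regular z})) ?_ ?_ ?_ v u
    · rintro _ ⟨z, -, rfl⟩
      exact isClosed_cone
    · intro y
      obtain ⟨z, hz, hyz⟩ := cs.exists_regular_mem_cone y
      exact ⟨_, ⟨z, hz, rfl⟩, hyz⟩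
    · rintro _ ⟨z, hz, rfl⟩ x hx y hy
      obtain ⟨k, hk, w', -, hgk, -, hkw⟩ := hex z hz
      rw [huniq x _ k hk hgk (hkw x hx), huniq y _ k hk hgk (hkw y hy),
        LinearIsometryEquiv.dist_map]
  have hlv : lin w v = v := by
    rw [hρv, hρu, hudef, map_add, hρq, dist_eq_norm, dist_eq_norm] at hdist
    have h1 := pow_le_pow_left₀ (norm_nonneg _) hdist 2
    have h2 : (inner ℝ v q : ℝ) = inner ℝ (lin w v) q := by
      rw [← LinearIsometryEquiv.inner_map_map (lin w) v q, hρq]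
    have h3 := real_inner_comm v (lin w v)
    have h4 := real_inner_comm v q
    have h5 := real_inner_comm (lin w v) q
    have h6 := LinearIsometryEquiv.norm_map (lin w) v
    have h7 : ‖lin w v - v‖ ^ 2 ≤ 0 := by
      rw [show v - (q + v) = -q by abel, norm_neg, norm_sub_sq_real, norm_add_sq_real,
        inner_add_right, h6] at h1
      rw [norm_sub_sq_real, h6]
      linarith
    rw [← sub_eq_zero, ← norm_le_zero_iff]
    nlinarith [norm_nonneg (lin w v - v)]
  have hlu : lin w u = u := by rw [hudef, map_add, hρq, hlv]
  obtain ⟨x, hx⟩ := hfh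
  obtain ⟨y, hy⟩ := hgh
  obtain ⟨t, ht, hm⟩ := hu.exists_smul_add_mem_cone (w x - y)
  refine ⟨x + t • u, fun c hc => B.eq_of_mem_range hf hg hv hfg ?_⟩
  have hc' : lin w c ∈ cs.cone u := by
    have := lin_mem_cone hw hc
    rwa [hlu] at this
  rw [add_assoc, hx _ (add_mem_cone (smul_mem_cone ht.le self_mem_cone) hc)]
  have e := hy _ (add_mem_cone hm hc')
  refine ⟨_, e.trans ?_⟩
  rw [Function.comp, apply_add, map_add, map_smul, hlu]
  congr 1
  abel

theorem agree_of_asym (hf : f ∈ B.charts) (hg : g ∈ B.charts) (hv : cs.Regular v)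
    (hu : cs.Regular u) (hfg : Agree f g (cs.cone v)) (h : Asym f u g u) :
    Agree f g (cs.cone u) := by
  obtain ⟨t, ht, hpos⟩ := cs.exists_forall_smul_add_pos u v
  obtain ⟨h1, h2⟩ := hu.of_pos hpos
  rw [← h2]
  exact B.agree_add hf hg hv h1 hfg (h.smul ht.le)
    (by rw [h2]; exact smul_mem_cone ht.le self_mem_cone)

end RBuilding

namespace SphericalCoxeterSystem

variable {n : ℕ}

/-- The vector `q` lies on the linear wall orthogonal to the root `a` and far from all other
linear walls. -/
structure WallPair (cs : SphericalCoxeterSystem n) (a q : ModelSpace n) : Prop where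
  root : a ∈ cs.roots
  inner_eq : (inner ℝ a q : ℝ) = 0
  one_lt_abs : ∀ b ∈ cs.roots, b ≠ a → b ≠ -a → 1 < |(inner ℝ b q : ℝ)|

variable {cs : SphericalCoxeterSystem n} {a q y : ModelSpace n} {w : ModelSpace n ≃ᵢ ModelSpace n}

theorem abs_inner_root_le {b : ModelSpace n} (ha : a ∈ cs.roots) (hb : b ∈ cs.roots) :
    |(inner ℝ b a : ℝ)| ≤ 1 := by
  simpa [norm_root ha, norm_root hb] using abs_real_inner_le_norm b a

namespace WallPair

theorem neg_right (h : cs.WallPair a q) : cs.WallPair a (-q) :=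
  ⟨h.root, by rw [inner_neg_right, h.inner_eq, neg_zero], fun b hb h1 h2 => by
    rw [inner_neg_right, abs_neg]; exact h.one_lt_abs b hb h1 h2⟩

theorem neg_left (h : cs.WallPair a q) : cs.WallPair (-a) q :=
  ⟨neg_root h.root, by rw [inner_neg_left, h.inner_eq, neg_zero], fun b hb h1 h2 =>
    h.one_lt_abs b hb (by rwa [neg_neg] at h2) h1⟩

theorem mem_cone_iff (h : cs.WallPair a q) : y ∈ cs.cone (q + a) ↔
    (0 : ℝ) ≤ inner ℝ a y ∧ ∀ b ∈ cs.roots, (0 : ℝ) < inner ℝ b q → (0 : ℝ) ≤ inner ℝ b y := by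
  have haa := inner_root_self h.root
  constructor
  · intro hy
    refine ⟨hy a h.root ?_, fun b hb hbq => hy b hb ?_⟩
    · rw [inner_add_right, h.inner_eq, haa]; norm_num
    · have h1 : b ≠ a := by rintro rfl; rw [h.inner_eq] at hbq; exact lt_irrefl _ hbq
      have h2 : b ≠ -a := by
        rintro rfl; rw [inner_neg_left, h.inner_eq, neg_zero] at hbq; exact lt_irrefl _ hbq
      have h3 := h.one_lt_abs b hb h1 h2
      rw [abs_of_pos hbq] at h3
      have h4 := (abs_le.1 (abs_inner_root_le h.root hb)).1
      rw [inner_add_right]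
      linarith
  · rintro ⟨h1, h2⟩ b hb hbv
    rw [inner_add_right] at hbv
    by_cases e1 : b = a
    · rwa [e1]
    by_cases e2 : b = -a
    · rw [e2, inner_neg_left, inner_neg_left, h.inner_eq, haa] at hbv
      norm_num at hbv
    refine h2 b hb ?_
    have h3 := h.one_lt_abs b hb e1 e2
    have h4 := (abs_le.1 (abs_inner_root_le h.root hb)).2
    rcases lt_abs.1 h3 with h5 | h5 <;> linarith

theorem regular (h : cs.WallPair a q) : cs.Regular (q + a) := by
  intro b hb hbv
  have haa := inner_root_self h.root
  rw [inner_add_right] at hbv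
  by_cases e1 : b = a
  · rw [e1, h.inner_eq, haa] at hbv
    norm_num at hbv
  by_cases e2 : b = -a
  · rw [e2, inner_neg_left, inner_neg_left, h.inner_eq, haa] at hbv
    norm_num at hbv
  have h3 := h.one_lt_abs b hb e1 e2
  rw [eq_neg_of_add_eq_zero_left hbv, abs_neg] at h3
  exact absurd (abs_inner_root_le h.root hb) (not_le.2 h3)

theorem mem_cone (h : cs.WallPair a q) : q ∈ cs.cone (q + a) :=
  h.mem_cone_iff.2 ⟨h.inner_eq.ge, fun _ _ => le_of_lt⟩

theorem exists_smul_add_mem_cone (h : cs.WallPair a q) (hy : (0 : ℝ) ≤ inner ℝ a y) :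
    ∃ t : ℝ, 0 ≤ t ∧ t • q + y ∈ cs.cone (q + a) := by
  obtain ⟨t, ht, h1⟩ := cs.exists_forall_smul_add_pos q y
  refine ⟨t, ht.le, h.mem_cone_iff.2 ⟨?_, fun b hb hbq => (h1 b hb hbq).le⟩⟩
  rw [inner_add_right, real_inner_smul_right, h.inner_eq, mul_zero, zero_add]
  exact hy

theorem lin_eq_or (h : cs.WallPair a q) (hw : w ∈ cs.W) (hq : lin w q = q) :
    lin w a = a ∨ lin w a = -a := by
  by_contra! hne
  have h1 := h.one_lt_abs _ (lin_root hw h.root) hne.1 hne.2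
  rw [← hq, LinearIsometryEquiv.inner_map_map, h.inner_eq, abs_zero] at h1
  norm_num at h1

end WallPair

theorem eq_of_norm_add_eq {V : Type*} [NormedAddCommGroup V] [InnerProductSpace ℝ V] {x y : V}
    (h : ‖x‖ = ‖y‖) (h' : ‖x + y‖ = ‖y + y‖) : x = y := by
  have h1 := congrArg (· ^ 2) h'
  simp only [norm_add_sq_real, h, real_inner_self_eq_norm_sq] at h1
  rw [← sub_eq_zero, ← norm_le_zero_iff]
  have h2 : ‖x - y‖ ^ 2 = 0 := by rw [norm_sub_sq_real, h]; linarith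
  exact (pow_eq_zero_iff two_ne_zero |>.1 h2).le

theorem exists_eq_halfSpace_of_add_mem {E : Set (ModelSpace n)} (ha : a ∈ cs.roots)
    (hcl : IsClosed E) (hne : E.Nonempty) (huniv : E ≠ univ)
    (hadd : ∀ x ∈ E, ∀ y, (0 : ℝ) ≤ inner ℝ a y → x + y ∈ E) :
    ∃ k : ℝ, E = {x | k ≤ inner ℝ a x} := by
  have haa := inner_root_self ha
  have hmono : ∀ x ∈ E, ∀ y, (inner ℝ a x : ℝ) ≤ inner ℝ a y → y ∈ E := fun x hx y hxy => by
    have := hadd x hx (y - x) (by rw [inner_sub_right]; linarith)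
    rwa [add_sub_cancel] at this
  obtain ⟨x₁, hx₁⟩ := hne
  obtain ⟨x₂, hx₂⟩ := (ne_univ_iff_exists_notMem E).1 huniv
  set S : Set ℝ := (fun s : ℝ => s • a) ⁻¹' E with hS
  have hScl : IsClosed S := hcl.preimage (by fun_prop)
  have hmem : ∀ x, x ∈ E ↔ (inner ℝ a x : ℝ) ∈ S := fun x =>
    ⟨fun hx => hmono x hx _ (by rw [real_inner_smul_right, haa, mul_one]),
      fun hx => hmono _ hx x (by rw [real_inner_smul_right, haa, mul_one])⟩
  have hbdd : BddBelow S := ⟨inner ℝ a x₂, fun s hs => by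
    by_contra! hlt
    refine hx₂ (hmono _ hs x₂ ?_)
    rw [real_inner_smul_right, haa, mul_one]
    exact hlt.le⟩
  have hk := hScl.csInf_mem ⟨_, (hmem x₁).1 hx₁⟩ hbdd
  refine ⟨sInf S, Set.ext fun x => ⟨fun hx => csInf_le hbdd ((hmem x).1 hx), fun hx => ?_⟩⟩
  refine hmono _ hk x ?_
  rw [real_inner_smul_right, haa, mul_one]
  exact hx

end SphericalCoxeterSystem

namespace RBuilding

open SphericalCoxeterSystem

variable {n : ℕ} {cs : SphericalCoxeterSystem n} {X : Type*} [MetricSpace X] {Λ : Set X}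
  (B : RBuilding cs X Λ) {f g h : ModelSpace n → X} {a x y q : ModelSpace n}
  {w : ModelSpace n ≃ᵢ ModelSpace n}

theorem agree_opposite (hp : cs.WallPair a q) (hf : f ∈ B.charts) (hg : g ∈ B.charts)
    (hfg : Agree f g (cs.cone (q + a))) (hq : Asym f (-q) g (-q)) :
    Agree f g (cs.cone (-q + a)) := by
  have e : -q + (2⁻¹ : ℝ) • (q + a) = (2⁻¹ : ℝ) • (-q + a) := by module
  have h2 : (0 : ℝ) < 2⁻¹ := by norm_num
  have := B.agree_add (v := (2⁻¹ : ℝ) • (q + a)) (q := -q) hf hg (hp.regular.smul h2.ne')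
    (by rw [e]; exact hp.neg_right.regular.smul h2.ne') (by rwa [smul_cone h2]) hq
    (by rw [e, smul_cone h2]; exact hp.neg_right.mem_cone)
  rwa [e, smul_cone h2] at this

theorem add_mem_of_wallPair (hp : cs.WallPair a q) (hf : f ∈ B.charts) (hg : g ∈ B.charts)
    (hfg : Agree f g (cs.cone (q + a))) (hq : Asym f (-q) g (-q)) (hx : f x = g x)
    (hy : (0 : ℝ) ≤ inner ℝ a y) : f (x + y) = g (x + y) := by
  obtain ⟨t, ht, hm⟩ := hp.exists_smul_add_mem_cone hy
  have h1 := B.add_mem_setOf_eq hf hg hp.regular hfg hfg hx hm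
  have h2 := B.add_mem_setOf_eq hf hg hp.regular hfg (B.agree_opposite hp hf hg hfg hq) h1
    (smul_mem_cone ht hp.neg_right.mem_cone)
  rwa [show x + (t • q + y) + t • -q = x + y by module] at h2

theorem exists_setOf_eq_halfSpace (hp : cs.WallPair a q) (hf : f ∈ B.charts) (hg : g ∈ B.charts)
    (hfg : Agree f g (cs.cone (q + a))) (hq : Asym f (-q) g (-q)) (hne : f ≠ g) :
    ∃ k : ℝ, {x | f x = g x} = {x | k ≤ inner ℝ a x} := by
  refine exists_eq_halfSpace_of_add_mem hp.root (B.isClosed_setOf_eq hf hg hp.regular hfg) ?_ ?_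
    fun x hx y hy => B.add_mem_of_wallPair hp hf hg hfg hq hx hy
  · obtain ⟨x, hx⟩ := hfg
    exact ⟨x + 0, hx 0 zero_mem_cone⟩
  · intro h
    exact hne (funext fun x => (h.symm ▸ mem_univ x : x ∈ {x | f x = g x}))

theorem isHalfApartment_inter (hp : cs.WallPair a q) (hf : f ∈ B.charts) (hg : g ∈ B.charts)
    (hfg : Agree f g (cs.cone (q + a))) {k : ℝ}
    (hk : {x | f x = g x} = {x | k ≤ inner ℝ a x}) :
    IsHalfApartment cs B.charts (range f ∩ range g) := by
  refine ⟨f, hf, _, _, isModelHalf_halfSpace hp.root k, ?_⟩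
  rw [← hk, ← B.setOf_mem_range_eq hf hg hp.regular hfg]
  ext p
  constructor
  · rintro ⟨⟨x, rfl⟩, hx⟩
    exact ⟨x, hx, rfl⟩
  · rintro ⟨x, hx, rfl⟩
    exact ⟨⟨x, rfl⟩, hx⟩

/-- Crossing one wall at infinity. -/
theorem exists_chart_cross (hp : cs.WallPair a q) (hf : f ∈ B.charts) (hg : g ∈ B.charts)
    (hfg : Agree f g (cs.cone (q + a))) (x : ModelSpace n) :
    ∃ f₁ ∈ B.charts, ∃ x₁, Agree f₁ g (cs.cone (q + -a)) ∧
      ∀ y ∈ cs.cone (q + a), y ∈ cs.cone (q + -a) → f₁ (x₁ + y) = f (x + y) := by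
  by_cases hs : Agree f g (cs.cone (q + -a))
  · exact ⟨f, hf, x, hs, fun _ _ _ => rfl⟩
  have hif := B.isom f hf
  have hig := B.isom g hg
  have hpa := hp.neg_left
  have hpq := hp.neg_right
  have hpn := hp.neg_left.neg_right
  have hvs : q + a ≠ q + -a := fun e => by
    have h1 := congrArg (inner ℝ a) (add_left_cancel e)
    rw [inner_neg_right, inner_root_self hp.root] at h1
    norm_num at h1
  have hfgv : Asym f (q + a) g (q + a) := hfg.asym hif hig self_mem_cone
  have hfgq : Asym f q g q := hfg.asym hif hig hp.mem_cone
  obtain ⟨h₁, hh₁, w, hw, a₁, a₂⟩ := B.exists_chart_agree hf hg hpn.regular hpa.regular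
  have hi₁ := B.isom h₁ hh₁
  have hgh₁ : ∀ y ∈ cs.cone (q + -a), Asym g y h₁ (lin w y) := fun y hy =>
    (a₂.asym hig (B.isom _ (B.A1 h₁ hh₁ w hw)) hy).trans (asym_comp_lin hi₁ w y)
  have hfh₁n : Asym f (-q) h₁ (-q) := a₁.asym hif hi₁ hpn.mem_cone
  have hwq : lin w q = q := by
    refine eq_of_norm_add_eq (LinearIsometryEquiv.norm_map _ _) ?_
    have := (hfgq.trans (hgh₁ q hpa.mem_cone)).norm_sub_eq hif hi₁ hfh₁n
    rw [sub_neg_eq_add, sub_neg_eq_add] at this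
    exact this.symm
  have hfh₁q : Asym f q h₁ q := by
    have := hfgq.trans (hgh₁ q hpa.mem_cone)
    rwa [hwq] at this
  have hfh₁q' : Asym f (- -q) h₁ (- -q) := by rwa [neg_neg]
  have a₃ := B.agree_opposite hpn hf hh₁ a₁ hfh₁q'
  rw [neg_neg] at a₃
  rcases hp.lin_eq_or hw hwq with hwa | hwa
  · refine absurd (B.agree_of_asym hf hg hp.regular hpa.regular hfg ?_) hs
    have := hgh₁ _ self_mem_cone
    rw [map_add, map_neg, hwq, hwa] at this
    exact (a₃.asym hif hi₁ self_mem_cone).trans this.symm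
  have hgs : Asym g (q + -a) h₁ (q + a) := by
    have := hgh₁ _ self_mem_cone
    rwa [map_add, map_neg, hwq, hwa, neg_neg] at this
  have hne₁ : f ≠ h₁ := by
    rintro rfl
    exact hvs (Asym.eq hig (hfgv.symm.trans hgs.symm))
  obtain ⟨h₂, hh₂, w₂, hw₂, b₁, b₂⟩ := B.exists_chart_agree hf hh₁ hp.regular hpq.regular
  have hi₂ := B.isom h₂ hh₂
  have hh₂' := B.A1 h₂ hh₂ w₂ hw₂
  have hi₂' := B.isom _ hh₂'
  have hfh₂q : Asym f q h₂ q := b₁.asym hif hi₂ hp.mem_cone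
  have hn : Asym f (-q) h₂ (lin w₂ (-q)) :=
    (hfh₁n.trans (b₂.asym hi₁ hi₂' hpq.mem_cone)).trans (asym_comp_lin hi₂ w₂ _)
  have hw₂q : lin w₂ q = q := by
    refine eq_of_norm_add_eq (LinearIsometryEquiv.norm_map _ _) ?_
    have := hfh₂q.norm_sub_eq hif hi₂ hn
    rw [map_neg, sub_neg_eq_add, sub_neg_eq_add] at this
    rw [add_comm, this]
  have hc : ∀ y, Asym (h₂ ∘ w₂) y h₂ (lin w₂ y) := asym_comp_lin hi₂ w₂
  have hq₂ : Asym h₁ q (h₂ ∘ w₂) q := by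
    have := hc q
    rw [hw₂q] at this
    exact (hfh₁q.symm.trans hfh₂q).trans this.symm
  have hq₂' : Asym h₁ (- -q) (h₂ ∘ w₂) (- -q) := by rwa [neg_neg]
  have b₃ := B.agree_opposite hpq hh₁ hh₂' b₂ hq₂'
  rw [neg_neg] at b₃
  have hh₂g := (hc (q + a)).symm.trans ((b₃.asym hi₁ hi₂' self_mem_cone).symm.trans hgs.symm)
  have hfh₂v : Asym f (q + a) h₂ (q + a) := b₁.asym hif hi₂ self_mem_cone
  have hw₂a : lin w₂ a = -a := by
    refine (hp.lin_eq_or hw₂ hw₂q).resolve_left fun hw₂a => hvs (Asym.eq hig ?_)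
    rw [map_add, hw₂q, hw₂a] at hh₂g
    exact (hfgv.symm.trans hfh₂v).trans hh₂g
  rw [map_add, hw₂q, hw₂a] at hh₂g
  have hfh₂n : Asym f (-q) h₂ (-q) := by rwa [map_neg, hw₂q] at hn
  have hne₂ : f ≠ h₂ := by
    rintro rfl
    exact hs (B.agree_of_asym hf hg hp.regular hpa.regular hfg hh₂g)
  have hne₃ : h₁ ≠ h₂ ∘ w₂ := by
    intro e
    have := hc (q + -a)
    rw [← e, map_add, map_neg, hw₂q, hw₂a, neg_neg] at this
    exact hvs (Asym.eq hif
      (hfh₂v.trans (this.symm.trans (a₃.asym hif hi₁ self_mem_cone).symm)))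
  obtain ⟨k₁, hk₁⟩ := B.exists_setOf_eq_halfSpace hpn hf hh₁ a₁ hfh₁q' hne₁
  obtain ⟨k₂, hk₂⟩ := B.exists_setOf_eq_halfSpace hp hf hh₂ b₁ hfh₂n hne₂
  obtain ⟨k₃, hk₃⟩ := B.exists_setOf_eq_halfSpace hpq hh₁ hh₂' b₂ hq₂' hne₃
  have hrange : range (h₂ ∘ w₂) = range h₂ := w₂.surjective.range_comp h₂
  have hhalf := B.isHalfApartment_inter hpq hh₁ hh₂' b₂ hk₃
  rw [hrange] at hhalf
  have hk : k₂ ≤ -k₁ := by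
    obtain ⟨p, ⟨⟨y, rfl⟩, hy₁⟩, hy₂⟩ := B.A5 f hf h₁ hh₁ h₂ hh₂
      (B.isHalfApartment_inter hpn hf hh₁ a₁ hk₁) hhalf (B.isHalfApartment_inter hp hf hh₂ b₁ hk₂)
    have m₁ : y ∈ {x | f x = h₁ x} := B.eq_of_mem_range hf hh₁ hpn.regular a₁ hy₁
    have m₂ : y ∈ {x | f x = h₂ x} := B.eq_of_mem_range hf hh₂ hp.regular b₁ hy₂
    rw [hk₁] at m₁
    rw [hk₂] at m₂
    have m₁' : k₁ ≤ inner ℝ (-a) y := m₁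
    have m₂' : k₂ ≤ inner ℝ a y := m₂
    rw [inner_neg_left] at m₁'
    linarith
  rcases le_total (inner ℝ a x : ℝ) (-k₁) with hx | hx
  · have hx₁ : x ∈ {x | f x = h₁ x} := by
      rw [hk₁]
      show k₁ ≤ inner ℝ (-a) x
      rw [inner_neg_left]
      linarith
    refine ⟨h₁ ∘ w, B.A1 h₁ hh₁ w hw, w⁻¹ x, a₂.symm, fun y hy hy' => ?_⟩
    have hwy : lin w y = y := Asym.eq hi₁ ((hgh₁ y hy').symm.trans
      ((hfg.asym hif hig hy).symm.trans (a₃.asym hif hi₁ hy')))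
    rw [Function.comp, apply_add, apply_inv_apply, hwy]
    exact (B.add_mem_of_wallPair hpn hf hh₁ a₁ hfh₁q' hx₁ (hpa.mem_cone_iff.1 hy').1).symm
  · have hx₂ : x ∈ {x | f x = h₂ x} := by
      rw [hk₂]
      exact hk.trans hx
    refine ⟨h₂, hh₂, x, ?_, fun y hy _ =>
      (B.add_mem_of_wallPair hp hf hh₂ b₁ hfh₂n hx₂ (hp.mem_cone_iff.1 hy).1).symm⟩
    exact B.agree_of_asym hh₂ hg hp.regular hpa.regular (b₁.symm.trans hp.regular hfg) hh₂g

end RBuilding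

namespace SphericalCoxeterSystem

variable {n : ℕ} {cs : SphericalCoxeterSystem n} {a q u v v' z z' : ModelSpace n}

theorem Regular.inner_pos_of_cone_eq (hv : cs.Regular v) (h : cs.cone v = cs.cone u)
    {b : ModelSpace n} (hb : b ∈ cs.roots) (hbu : (0 : ℝ) < inner ℝ b u) :
    (0 : ℝ) < inner ℝ b v := by
  have : v ∈ cs.cone u := h ▸ self_mem_cone
  exact lt_of_le_of_ne (this b hb hbu.le) (hv b hb).symm

theorem eq_or_eq_neg_of_smul_eq (ha : ‖a‖ = 1) {b : ModelSpace n} (hb : ‖b‖ = 1) {s t : ℝ}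
    (hs : s ≠ 0) (h : s • a = t • b) : a = b ∨ a = -b := by
  have h1 := congrArg norm h
  rw [norm_smul, norm_smul, ha, hb, mul_one, mul_one, Real.norm_eq_abs, Real.norm_eq_abs] at h1
  rcases abs_eq_abs.1 h1 with rfl | h2
  · exact Or.inl (smul_right_injective _ hs h)
  · refine Or.inr (smul_right_injective _ hs ?_)
    show s • a = s • -b
    rw [h, h2, neg_smul, smul_neg, neg_neg]

theorem exists_smul_wallPair (ha : a ∈ cs.roots) (haq : (inner ℝ a q : ℝ) = 0)
    (hne : ∀ b ∈ cs.roots, b ≠ a → b ≠ -a → (inner ℝ b q : ℝ) ≠ 0) :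
    ∃ t : ℝ, 0 < t ∧ cs.WallPair a (t • q) := by
  have h : ∀ᶠ t : ℝ in Filter.atTop, ∀ b ∈ cs.roots, (inner ℝ b q : ℝ) ≠ 0 →
      1 < t * |(inner ℝ b q : ℝ)| := by
    rw [Filter.eventually_all_finite finite_roots]
    intro b _
    by_cases hb : (inner ℝ b q : ℝ) = 0
    · exact Filter.Eventually.of_forall fun _ h => absurd hb h
    · filter_upwards [(Filter.tendsto_id.atTop_mul_const (abs_pos.2 hb)).eventually_gt_atTop 1]
        with t ht _ using ht
  obtain ⟨t, ht, ht0⟩ := (h.and (Filter.eventually_gt_atTop 0)).exists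
  refine ⟨t, ht0, ha, by rw [real_inner_smul_right, haq, mul_zero], fun b hb h1 h2 => ?_⟩
  rw [real_inner_smul_right, abs_mul, abs_of_pos ht0]
  exact ht b hb (hne b hb h1 h2)

/-- If some root separates `v` from `v'`, then the chamber of `v` has a panel whose wall
separates `v` from `v'`. -/
theorem exists_wallPair_cone_eq (hv : cs.Regular v) (hv' : cs.Regular v')
    (hsep : ∃ b ∈ cs.roots, (0 : ℝ) < inner ℝ b v ∧ (inner ℝ b v' : ℝ) < 0) :
    ∃ a q, cs.WallPair a q ∧ cs.cone (q + a) = cs.cone v ∧ (inner ℝ a v' : ℝ) < 0 := by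
  set T : Set (ModelSpace n) := Set.image2
    (fun a b : ModelSpace n => (inner ℝ b v' : ℝ) • a - (inner ℝ a v' : ℝ) • b)
    cs.roots cs.roots \ {0} with hT
  have hTfin : T.Finite := (finite_roots.image2 _ finite_roots).subset sdiff_subset
  obtain ⟨u, hu, hpos⟩ := cs.exists_generic v hTfin fun a ha => ha.2
  obtain ⟨hur, huv⟩ := hv.of_pos hpos
  have hSfin : {b | b ∈ cs.roots ∧ (0 : ℝ) < inner ℝ b u ∧ (inner ℝ b v' : ℝ) < 0}.Finite :=
    finite_roots.subset fun b hb => hb.1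
  obtain ⟨b₀, hb₀, h₀, h₀'⟩ := hsep
  obtain ⟨a, ⟨ha, hau, hav'⟩, hmin⟩ := hSfin.exists_minimalFor
    (fun b => (inner ℝ b u : ℝ) / -inner ℝ b v') _ ⟨b₀, hb₀, hpos b₀ hb₀ h₀, h₀'⟩
  set r : ℝ := inner ℝ a u / -inner ℝ a v' with hr
  have hr0 : 0 < r := div_pos hau (neg_pos.2 hav')
  have hrmul : r * inner ℝ a v' = -inner ℝ a u := by
    rw [hr, div_neg, neg_mul, div_mul_cancel₀ _ hav'.ne]
  have hinner : ∀ b, (inner ℝ b (u + r • v') : ℝ) = inner ℝ b u + r * inner ℝ b v' := fun b => by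
    rw [inner_add_right, real_inner_smul_right]
  have hne : ∀ b ∈ cs.roots, b ≠ a → b ≠ -a → (inner ℝ b (u + r • v') : ℝ) ≠ 0 := by
    intro b hb h1 h2 h0
    have hne0 : (inner ℝ b v' : ℝ) • a - (inner ℝ a v' : ℝ) • b ≠ 0 := fun e => by
      rcases eq_or_eq_neg_of_smul_eq (norm_root ha) (norm_root hb) (hv' b hb) (sub_eq_zero.1 e)
        with e | e
      · exact h1 e.symm
      · exact h2 (by rw [e, neg_neg])
    refine hu _ ⟨⟨a, ha, b, hb, rfl⟩, hne0⟩ ?_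
    rw [hinner] at h0
    rw [inner_sub_left, real_inner_smul_left, real_inner_smul_left]
    linear_combination (inner ℝ b v' : ℝ) * hrmul - (inner ℝ a v' : ℝ) * h0
  obtain ⟨t, ht, hp⟩ := exists_smul_wallPair ha (by rw [hinner, hrmul, add_neg_cancel]) hne
  refine ⟨a, _, hp, ?_, hav'⟩
  rw [← huv]
  refine (hur.of_pos fun b hb hbu => ?_).2
  by_cases e1 : b = a
  · rw [e1, inner_add_right, hp.inner_eq, inner_root_self ha]
    norm_num
  by_cases e2 : b = -a
  · rw [e2, inner_neg_left] at hbu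
    linarith
  have h3 : (0 : ℝ) ≤ inner ℝ b (u + r • v') := by
    rw [hinner]
    rcases le_or_gt 0 (inner ℝ b v' : ℝ) with hb0 | hb0
    · positivity
    · have h4 : r ≤ inner ℝ b u / -inner ℝ b v' := by
        by_contra! hlt
        exact absurd (hmin ⟨hb, hbu, hb0⟩ hlt.le) (not_le.2 hlt)
      rw [le_div_iff₀ (neg_pos.2 hb0)] at h4
      linarith
  have h4 := hp.one_lt_abs b hb e1 e2
  rw [real_inner_smul_right, abs_of_nonneg (mul_nonneg ht.le h3)] at h4
  have h5 := (abs_le.1 (abs_inner_root_le ha hb)).1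
  rw [inner_add_right, real_inner_smul_right]
  linarith

theorem cone_subset_of_par {X : Type*} [MetricSpace X] {h : ModelSpace n → X} (hh : Isometry h)
    {x : ModelSpace n}
    (hp : Par (h '' {y | y - x ∈ cs.cone z}) (h '' {y | y - x ∈ cs.cone z'})) :
    cs.cone z ⊆ cs.cone z' := by
  intro y hy a ha haz
  by_contra! hneg
  have hfin : Metric.hausdorffEDist {y | y - x ∈ cs.cone z} {y | y - x ∈ cs.cone z'} ≠ ⊤ := by
    rw [← Metric.hausdorffEDist_image hh]
    exact hp
  obtain ⟨R, hR⟩ := ENNReal.lt_iff_exists_nnreal_btwn.1 (lt_top_iff_ne_top.2 hfin)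
  have key : ∀ t : ℝ, 0 ≤ t → -(R : ℝ) ≤ t * inner ℝ a y := by
    intro t ht
    obtain ⟨y', hy', hlt⟩ := Metric.exists_edist_lt_of_hausdorffEDist_lt
      (add_mem_setOf_sub_mem (x := x) (smul_mem_cone ht hy)) hR.1
    have h1 : dist (x + t • y) y' < R := by
      rwa [edist_nndist, ENNReal.coe_lt_coe, ← NNReal.coe_lt_coe, coe_nndist] at hlt
    have h2 : (0 : ℝ) ≤ inner ℝ a (y' - x) := hy' a ha haz
    have h3 := abs_le.1 (abs_real_inner_le_norm a (x + t • y - y'))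
    rw [norm_root ha, one_mul, ← dist_eq_norm] at h3
    have h4 : (inner ℝ a (x + t • y - y') : ℝ) = t * inner ℝ a y - inner ℝ a (y' - x) := by
      rw [← real_inner_smul_right, ← inner_sub_right]
      congr 1
      abel
    rw [h4] at h3
    linarith [h3.1]
  have h1 := key ((R + 1) / -inner ℝ a y) (div_nonneg (by positivity) (by linarith))
  rw [div_neg, neg_mul, div_mul_cancel₀ _ hneg.ne] at h1
  linarith

theorem Agree.par {X : Type*} [MetricSpace X] {f g : ModelSpace n → X} (hf : Isometry f)
    (hg : Isometry g) (hfg : Agree f g (cs.cone u)) (hz : z ∈ cs.cone u) (x x' : ModelSpace n) :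
    Par (f '' {y | y - x ∈ cs.cone z}) (g '' {y | y - x' ∈ cs.cone z}) := by
  obtain ⟨p, hp⟩ := hfg
  have key : ∀ c ∈ cs.cone z, edist (f (x + c)) (g (x' + c)) ≤ edist x p + edist p x' := by
    intro c hc
    refine (edist_triangle _ (f (p + c)) _).trans (add_le_add ?_ ?_)
    · rw [hf.edist_eq, edist_add_right]
    · rw [hp c (cone_subset hz hc), hg.edist_eq, edist_add_right]
  have htop : edist x p + edist p x' ≠ ⊤ := ENNReal.add_ne_top.2 ⟨edist_ne_top _ _, edist_ne_top _ _⟩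
  refine ne_top_of_le_ne_top htop (Metric.hausdorffEDist_le_of_mem_edist ?_ ?_)
  · rintro _ ⟨y, hy, rfl⟩
    refine ⟨_, ⟨x' + (y - x), add_mem_setOf_sub_mem hy, rfl⟩, ?_⟩
    simpa using key _ hy
  · rintro _ ⟨y, hy, rfl⟩
    refine ⟨_, ⟨x + (y - x'), add_mem_setOf_sub_mem hy, rfl⟩, ?_⟩
    rw [edist_comm]
    simpa using key _ hy

end SphericalCoxeterSystem

section Par

variable {X : Type*} [MetricSpace X] {S T U : Set X}

theorem Par.symm (h : Par S T) : Par T S :=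
  (Metric.hausdorffEDist_comm (s := T) (t := S)).trans_ne h

theorem Par.trans (h₁ : Par S T) (h₂ : Par T U) : Par S U :=
  ne_top_of_le_ne_top (ENNReal.add_ne_top.2 ⟨h₁, h₂⟩) Metric.hausdorffEDist_triangle

end Par

namespace RBuilding

open SphericalCoxeterSystem

variable {n : ℕ} {cs : SphericalCoxeterSystem n} {X : Type*} [MetricSpace X] {Λ : Set X}
  (B : RBuilding cs X Λ) {f g h k : ModelSpace n → X} {x x' y z z' u u' v v' : ModelSpace n}
  {w : ModelSpace n ≃ᵢ ModelSpace n}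

/-- Moving from one chamber at infinity of an apartment to another one while fixing their
common face. -/
theorem exists_chart_gallery (hg : g ∈ B.charts) (hv' : cs.Regular v') (N : ℕ) :
    ∀ (v : ModelSpace n) (f : ModelSpace n → X) (x : ModelSpace n), cs.Regular v →
      f ∈ B.charts → Agree f g (cs.cone v) →
      {b | b ∈ cs.roots ∧ (0 : ℝ) < inner ℝ b v ∧ (inner ℝ b v' : ℝ) < 0}.ncard = N →
      ∃ f' ∈ B.charts, ∃ x', Agree f' g (cs.cone v') ∧
        ∀ y ∈ cs.cone v, y ∈ cs.cone v' → f' (x' + y) = f (x + y) := by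
  induction N using Nat.strong_induction_on with
  | _ N ih =>
    intro v f x hv hf hfg hN
    by_cases hsep : ∃ b ∈ cs.roots, (0 : ℝ) < inner ℝ b v ∧ (inner ℝ b v' : ℝ) < 0
    · obtain ⟨a, q, hp, hcone, hav'⟩ := exists_wallPair_cone_eq hv hv' hsep
      rw [← hcone] at hfg
      obtain ⟨f₁, hf₁, x₁, hf₁g, h₁⟩ := B.exists_chart_cross hp hf hg hfg x
      have hlt : {b | b ∈ cs.roots ∧ (0 : ℝ) < inner ℝ b (q + -a) ∧
          (inner ℝ b v' : ℝ) < 0}.ncard < N := by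
        rw [← hN]
        refine Set.ncard_lt_ncard ⟨?_, fun hsub => ?_⟩ (finite_roots.subset fun b hb => hb.1)
        · rintro b ⟨hb, h1, h2⟩
          refine ⟨hb, ?_, h2⟩
          refine hv.inner_pos_of_cone_eq hcone.symm hb ?_
          have hba : b ≠ a := by
            rintro rfl
            rw [inner_add_right, inner_neg_right, hp.inner_eq, inner_root_self hb] at h1
            norm_num at h1
          have hba' : b ≠ -a := by
            rintro rfl
            rw [inner_neg_left] at h2
            linarith
          have h3 := hp.one_lt_abs b hb hba hba'
          have h4 := abs_le.1 (abs_inner_root_le hp.root hb)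
          rw [inner_add_right, inner_neg_right] at h1
          rw [inner_add_right]
          rcases lt_abs.1 h3 with h5 | h5 <;> linarith [h4.1, h4.2]
        · have hapos : (0 : ℝ) < inner ℝ a (q + a) := by
            rw [inner_add_right, hp.inner_eq, inner_root_self hp.root]
            norm_num
          have := (hsub ⟨hp.root, hv.inner_pos_of_cone_eq hcone.symm hp.root hapos, hav'⟩).2.1
          rw [inner_add_right, inner_neg_right, hp.inner_eq, inner_root_self hp.root] at this
          norm_num at this
      obtain ⟨f', hf', x', hf'g, h'⟩ := ih _ hlt (q + -a) f₁ x₁ hp.neg_left.regular hf₁ hf₁g rfl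
      refine ⟨f', hf', x', hf'g, fun y hy hy' => ?_⟩
      rw [← hcone] at hy
      have hy₁ : y ∈ cs.cone (q + -a) := hp.neg_left.mem_cone_iff.2
        ⟨hy' _ (neg_root hp.root) (by rw [inner_neg_left]; linarith), (hp.mem_cone_iff.1 hy).2⟩
      rw [h' y hy₁ hy', h₁ y hy hy₁]
    · push Not at hsep
      refine ⟨f, hf, x, ?_, fun _ _ _ => rfl⟩
      rwa [← (hv.of_pos fun b hb hbv => lt_of_le_of_ne (hsep b hb hbv) (hv' b hb).symm).2] at hfg

theorem exists_chart_of_agree (hf : f ∈ B.charts) (hg : g ∈ B.charts) (hv : cs.Regular v)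
    (hv' : cs.Regular v') (hfg : Agree f g (cs.cone v)) (x : ModelSpace n) :
    ∃ f' ∈ B.charts, ∃ x', Agree f' g (cs.cone v') ∧
      ∀ y ∈ cs.cone v, y ∈ cs.cone v' → f' (x' + y) = f (x + y) :=
  B.exists_chart_gallery hg hv' _ v f x hv hf hfg rfl

theorem exists_sectorFaceAt_par {α : X} (hα : α ∈ Λ) {F₀ : Set X}
    (hF₀ : IsSectorFace cs B.charts F₀) : ∃ F, IsSectorFaceAt cs B.charts α F ∧ Par F F₀ := by
  obtain ⟨-, g, hg, x₀, s, hs, -, rfl⟩ := hF₀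
  obtain ⟨z, rfl⟩ := hs.exists_cone
  obtain ⟨u, hu, hz⟩ := cs.exists_regular_mem_cone z
  obtain ⟨f, hf, ⟨x, rfl⟩, -⟩ := B.A3 α hα α hα
  obtain ⟨h, hh, w, hw, a₁, a₂⟩ := B.exists_chart_agree hf hg hu hu
  obtain ⟨f', hf', x', hf'h, hx'⟩ := B.exists_chart_of_agree hf hh hu (hu.lin hw) a₁ x
  have e := hx' 0 zero_mem_cone zero_mem_cone
  rw [add_zero, add_zero] at e
  have hf'w := B.A1 f' hf' w hw
  refine ⟨_, ⟨f' ∘ w, hf'w, w⁻¹ x', _, cs.isModelSectorFace_cone _ z, ?_, rfl⟩, ?_⟩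
  · rw [Function.comp, apply_inv_apply, e]
  · exact ((hf'h.comp hw).trans hu a₂.symm).par (B.isom _ hf'w) (B.isom g hg) hz _ _

theorem image_eq_of_par (hf : f ∈ B.charts) (hk : k ∈ B.charts) (hh : h ∈ B.charts)
    (hu : cs.Regular u) (hu' : cs.Regular u') (hfh : Agree f h (cs.cone u))
    (hkh : Agree k h (cs.cone u')) (hz : z ∈ cs.cone u) (hz' : z' ∈ cs.cone u')
    (hx : f x = k x')
    (hp : Par (f '' {y | y - x ∈ cs.cone z}) (k '' {y | y - x' ∈ cs.cone z'})) :
    f '' {y | y - x ∈ cs.cone z} = k '' {y | y - x' ∈ cs.cone z'} := by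
  have hif := B.isom f hf
  have hik := B.isom k hk
  have hih := B.isom h hh
  have hp' := ((hfh.par hif hih hz x 0).symm.trans hp).trans (hkh.par hik hih hz' x' 0)
  have hcone : cs.cone z = cs.cone z' :=
    Subset.antisymm (cone_subset_of_par hih hp') (cone_subset_of_par hih hp'.symm)
  obtain ⟨f₁, hf₁, x₁, hf₁h, h₁⟩ := B.exists_chart_of_agree hf hh hu hu' hfh x
  have hf₁k := hf₁h.trans hu' hkh.symm
  have e := h₁ 0 zero_mem_cone zero_mem_cone
  rw [add_zero, add_zero, hx] at e
  have e₁ : f₁ x₁ = k x₁ := B.eq_of_mem_range hf₁ hk hu' hf₁k ⟨x', e.symm⟩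
  obtain rfl : x₁ = x' := hik.injective (e₁.symm.trans e)
  have key : ∀ c ∈ cs.cone z, f (x + c) = k (x₁ + c) := fun c hc => by
    have hc' := cone_subset hz' (hcone ▸ hc)
    rw [← h₁ c (cone_subset hz hc) hc']
    exact B.add_mem_setOf_eq hf₁ hk hu' hf₁k hf₁k e₁ hc'
  rw [← hcone]
  ext p
  constructor
  · rintro ⟨y, hy, rfl⟩
    refine ⟨x₁ + (y - x), add_mem_setOf_sub_mem hy, ?_⟩
    rw [← key _ hy, add_sub_cancel]
  · rintro ⟨y, hy, rfl⟩
    refine ⟨x + (y - x₁), add_mem_setOf_sub_mem hy, ?_⟩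
    rw [key _ hy, add_sub_cancel]

theorem sectorFaceAt_eq_of_par {α : X} {F F' : Set X} (hF : IsSectorFaceAt cs B.charts α F)
    (hF' : IsSectorFaceAt cs B.charts α F') (hp : Par F F') : F = F' := by
  obtain ⟨f, hf, x, s, hs, hx, rfl⟩ := hF
  obtain ⟨f', hf', x', s', hs', hx', rfl⟩ := hF'
  obtain ⟨z, rfl⟩ := hs.exists_cone
  obtain ⟨z', rfl⟩ := hs'.exists_cone
  obtain ⟨u, hu, hz⟩ := cs.exists_regular_mem_cone z
  obtain ⟨u', hu', hz'⟩ := cs.exists_regular_mem_cone z'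
  obtain ⟨h, hh, w, hw, a₁, a₂⟩ := B.exists_chart_agree hf hf' hu hu'
  have hset : f' '' {y | y - x' ∈ cs.cone z'} =
      (f' ∘ (w⁻¹ : ModelSpace n ≃ᵢ ModelSpace n)) '' {y | y - w x' ∈ cs.cone (lin w z')} := by
    rw [image_comp]
    congr 1
    ext y
    constructor
    · intro hy
      refine ⟨w y, ?_, inv_apply_apply w y⟩
      have e := apply_add w x' (y - x')
      rw [add_sub_cancel] at e
      rw [e]
      exact add_mem_setOf_sub_mem (lin_mem_cone hw hy)
    · rintro ⟨y, hy, rfl⟩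
      have e := apply_add w⁻¹ (w x') (y - w x')
      rw [add_sub_cancel, inv_apply_apply] at e
      rw [e]
      refine add_mem_setOf_sub_mem ?_
      have := lin_mem_cone (inv_mem hw) hy
      rwa [lin_inv_lin] at this
  rw [hset] at hp ⊢
  have hkh : Agree (f' ∘ (w⁻¹ : ModelSpace n ≃ᵢ ModelSpace n)) h (cs.cone (lin w u')) := by
    rw [← lin_inv_lin w u'] at a₂
    have := a₂.comp (inv_mem hw)
    convert this using 1
    ext y
    simp only [Function.comp, apply_inv_apply]
  refine B.image_eq_of_par hf (B.A1 f' hf' _ (inv_mem hw)) hh hu (hu'.lin hw) a₁ hkh hz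
    (lin_mem_cone hw hz') ?_ hp
  rw [Function.comp, inv_apply_apply, hx, hx']

end RBuilding

/-- **Corollary of Parreau Prop. 1.8/Cor. 1.9.** For every point `α` and
every direction of a sector-face (represented by a sector-face `F₀`) there is a unique
sector-face based at `α` with that direction. -/
theorem existsUnique_sectorFace_direction
    {n : ℕ} (cs : SphericalCoxeterSystem n) {X : Type*} [MetricSpace X]
    {Λ : Set X} (B : RBuilding cs X Λ)
    (F₀ : Set X) (hF₀ : IsSectorFace cs B.charts F₀)
    (α : X) (hα : α ∈ Λ) :
    ∃! F : Set X, IsSectorFaceAt cs B.charts α F ∧ Par F F₀ := by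
  obtain ⟨F, hF, hp⟩ := B.exists_sectorFaceAt_par hα hF₀
  exact ⟨F, ⟨hF, hp⟩, fun F' hF' =>
    B.sectorFaceAt_eq_of_par hF'.1 hF (hF'.2.trans hp.symm)⟩
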